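/- Suppose M is a computable cofinally ultrahomogeneous structure. Then M is 0'''-computably cofinally ultrahomogeneous, where 0''' is the triple Turing jump of the least Turing degree. -/

import Mathlib

/- Self-contained framework for computable ages and cofinal Fraïssé limits. -/

namespace CFL

open Classical

/-! ### Oracle computability -/

/-- The characteristic partial function of a set of naturals. -/
noncomputable def chi (A : Set ℕ) : ℕ →. ℕ :=
  fun n => Part.some (if n ∈ A then 1 else 0)

/-- Codes for oracle partial recursive functions. -/
inductive OCode : Type
  | zero : OCode
  | succ : OCode
  | left : OCode
  | right : OCode
  | oracle : OCode
  | pair : OCode → OCode → OCode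
  | comp : OCode → OCode → OCode
  | prec : OCode → OCode → OCode
  | rfind' : OCode → OCode

/-- Evaluation of an oracle code relative to an oracle `O`. -/
def OCode.eval (O : ℕ →. ℕ) : OCode → ℕ →. ℕ
  | OCode.zero => pure 0
  | OCode.succ => Nat.succ
  | OCode.left => ↑fun n : ℕ => n.unpair.1
  | OCode.right => ↑fun n : ℕ => n.unpair.2
  | OCode.oracle => O
  | OCode.pair cf cg => fun n => Nat.pair <$> OCode.eval O cf n <*> OCode.eval O cg n
  | OCode.comp cf cg => fun n => OCode.eval O cg n >>= OCode.eval O cf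
  | OCode.prec cf cg =>
    Nat.unpaired fun a n =>
      n.rec (OCode.eval O cf a) fun y IH => do
        let i ← IH
        OCode.eval O cg (Nat.pair a (Nat.pair y i))
  | OCode.rfind' cf =>
    Nat.unpaired fun a m =>
      (Nat.rfind fun n => (fun m => m = 0) <$> OCode.eval O cf (Nat.pair a (n + m))).map
        (· + m)

/-- A numerical code of an `OCode`. -/
def OCode.encodeCode : OCode → ℕ
  | OCode.zero => 0
  | OCode.succ => 1
  | OCode.left => 2
  | OCode.right => 3
  | OCode.oracle => 4
  | OCode.pair cf cg => 4 * Nat.pair cf.encodeCode cg.encodeCode + 5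
  | OCode.comp cf cg => 4 * Nat.pair cf.encodeCode cg.encodeCode + 6
  | OCode.prec cf cg => 4 * Nat.pair cf.encodeCode cg.encodeCode + 7
  | OCode.rfind' cf => 4 * cf.encodeCode + 8

/-- `f` is a partial function recursive in the oracle set `O`. -/
def RecFunIn (O : Set ℕ) (f : ℕ →. ℕ) : Prop :=
  ∃ c : OCode, OCode.eval (chi O) c = f

/-- The code `c` computes the total function `f` relative to the oracle set `O`. -/
def ComputesIn (O : Set ℕ) (c : OCode) (f : ℕ → ℕ) : Prop :=
  ∀ n, OCode.eval (chi O) c n = Part.some (f n)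

/-- `f` is a total function computable in the oracle set `O`. -/
def TotalComputableIn (O : Set ℕ) (f : ℕ → ℕ) : Prop :=
  ∃ c : OCode, ComputesIn O c f

/-- The set `A` is computable in the oracle set `O`. -/
def SetRecIn (O A : Set ℕ) : Prop := RecFunIn O (chi A)

/-- Turing reducibility (on sets of naturals, regarded as representatives of
Turing degrees). -/
def TuringLE (A B : Set ℕ) : Prop := SetRecIn B A

/-- The set `A` is computably enumerable in the oracle set `O`. -/
def CEIn (O A : Set ℕ) : Prop :=
  ∃ c : OCode, ∀ n, n ∈ A ↔ (OCode.eval (chi O) c n).Dom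

/-- The Turing jump of a set of naturals. -/
def jump (O : Set ℕ) : Set ℕ :=
  { e | ∃ c : OCode, c.encodeCode = (Nat.unpair e).1 ∧
      (OCode.eval (chi O) c (Nat.unpair e).2).Dom }

/-- `0'`, the jump of the least degree. -/
def zeroJump : Set ℕ := jump ∅

/-- `0''`. -/
def zeroJump2 : Set ℕ := jump zeroJump

/-- `0'''`. -/
def zeroJump3 : Set ℕ := jump zeroJump2

/-! ### Languages and structures -/

/-- A (coded) first-order language: `relArity r = some k` means that `r` is the code of a
relation symbol of arity `k`, and similarly for function symbols. -/
structure Lang where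
  relArity : ℕ → Option ℕ
  funArity : ℕ → Option ℕ

/-- The language is computably represented. -/
def Lang.ComputableRep (L : Lang) : Prop :=
  TotalComputableIn ∅ (fun r => Encodable.encode (L.relArity r)) ∧
  TotalComputableIn ∅ (fun f => Encodable.encode (L.funArity f))

/-- A finite relational language. -/
def Lang.FiniteRelational (L : Lang) : Prop :=
  (∀ f, L.funArity f = none) ∧ { r | (L.relArity r).isSome = true }.Finite

/-- A finite language. -/
def Lang.FiniteLang (L : Lang) : Prop :=
  { r | (L.relArity r).isSome = true }.Finite ∧
  { f | (L.funArity f).isSome = true }.Finite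

/-- An `L`-structure with underlying set a set of naturals. -/
structure Str (L : Lang) where
  dom : Set ℕ
  rel : ℕ → List ℕ → Prop
  fn : ℕ → List ℕ → ℕ
  rel_valid : ∀ r as, rel r as → L.relArity r = some as.length ∧ ∀ x ∈ as, x ∈ dom
  fn_mem : ∀ f as, L.funArity f = some as.length → (∀ x ∈ as, x ∈ dom) → fn f as ∈ dom

variable {L : Lang}

/-- The (finite) tuple `as` lies in the structure `A`. -/
def TupleIn (A : Str L) (as : List ℕ) : Prop := ∀ x ∈ as, x ∈ A.dom

/-- Membership in the substructure of `A` generated by the tuple `s`. -/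
inductive InClosure (A : Str L) (s : List ℕ) : ℕ → Prop
  | base {x : ℕ} : x ∈ s → x ∈ A.dom → InClosure A s x
  | fn (f : ℕ) (as : List ℕ) : L.funArity f = some as.length →
      (∀ x ∈ as, InClosure A s x) → InClosure A s (A.fn f as)

theorem InClosure.mem_dom {A : Str L} {s : List ℕ} {x : ℕ}
    (h : InClosure A s x) : x ∈ A.dom := by
  induction h with
  | base _ hx => exact hx
  | fn f as ha _ ih => exact A.fn_mem f as ha ih

/-- The substructure of `A` generated by the tuple `s`. -/
def Str.sub (A : Str L) (s : List ℕ) : Str L where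
  dom := { x | InClosure A s x }
  rel r as := A.rel r as ∧ ∀ x ∈ as, InClosure A s x
  fn := A.fn
  rel_valid := fun r as h => ⟨(A.rel_valid r as h.1).1, h.2⟩
  fn_mem := fun f as ha hm => InClosure.fn f as ha hm

/-- `h` is an embedding of `A` into `B`. -/
def IsEmbMap (A B : Str L) (h : ℕ → ℕ) : Prop :=
  (∀ x ∈ A.dom, h x ∈ B.dom) ∧
  (∀ x ∈ A.dom, ∀ y ∈ A.dom, h x = h y → x = y) ∧
  (∀ r as, TupleIn A as → (A.rel r as ↔ B.rel r (as.map h))) ∧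
  (∀ f as, L.funArity f = some as.length → TupleIn A as →
    h (A.fn f as) = B.fn f (as.map h))

/-- `A` embeds into `B`. -/
def Embeds (A B : Str L) : Prop := ∃ h, IsEmbMap A B h

/-- `h` is an isomorphism of `A` onto `B`. -/
def IsIsoMap (A B : Str L) (h : ℕ → ℕ) : Prop :=
  IsEmbMap A B h ∧ ∀ y ∈ B.dom, ∃ x ∈ A.dom, h x = y

/-- `A` and `B` are isomorphic. -/
def Isom (A B : Str L) : Prop := ∃ h, IsIsoMap A B h

/-- `as ∼cl bs`: the coordinatewise map extends to an isomorphism of generated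
substructures. -/
def ClSim (A : Str L) (as : List ℕ) (B : Str L) (bs : List ℕ) : Prop :=
  ∃ h : ℕ → ℕ, as.map h = bs ∧ IsIsoMap (A.sub as) (B.sub bs) h

/-- `as ∼tuple bs`: equal length and the same pattern of equalities among coordinates. -/
def TupleSim (as bs : List ℕ) : Prop :=
  ∃ h h' : ℕ → ℕ, as.map h = bs ∧ bs.map h' = as

/-- `A` is finitely generated. -/
def Str.FG (A : Str L) : Prop :=
  ∃ s : List ℕ, TupleIn A s ∧ ∀ x, x ∈ A.dom ↔ InClosure A s x

/-- `g` is an automorphism of `M`. -/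
def IsAutoOf (M : Str L) (g : ℕ → ℕ) : Prop := IsIsoMap M M g

/-! ### Ages (as isomorphism-closed classes) -/

/-- `B` belongs to the age of `M`, i.e. `B` is isomorphic to a finitely generated
substructure of `M`. -/
def AgeMemOf (M : Str L) (B : Str L) : Prop :=
  ∃ as : List ℕ, TupleIn M as ∧ Isom B (M.sub as)

/-- The age of a structure `M`. -/
def ageOf (M : Str L) : Set (Str L) := { B | AgeMemOf M B }

/-- The hereditary property. -/
def HP (C : Set (Str L)) : Prop :=
  ∀ B ∈ C, ∀ as : List ℕ, TupleIn B as → B.sub as ∈ C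

/-- The joint embedding property. -/
def JEP (C : Set (Str L)) : Prop :=
  ∀ A ∈ C, ∀ B ∈ C, ∃ D ∈ C, Embeds A D ∧ Embeds B D

/-- Every pair of embeddings with domain `A` into members of `C` can be amalgamated
over `A` inside `C`. -/
def AmalgamatesOver (C : Set (Str L)) (A : Str L) : Prop :=
  ∀ B₀ ∈ C, ∀ B₁ ∈ C, ∀ f₀ f₁ : ℕ → ℕ, IsEmbMap A B₀ f₀ → IsEmbMap A B₁ f₁ →
    ∃ D ∈ C, ∃ g₀ g₁ : ℕ → ℕ, IsEmbMap B₀ D g₀ ∧ IsEmbMap B₁ D g₁ ∧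
      ∀ x ∈ A.dom, g₀ (f₀ x) = g₁ (f₁ x)

/-- The amalgamation property. -/
def AP (C : Set (Str L)) : Prop := ∀ A ∈ C, AmalgamatesOver C A

/-- `A` is an amalgamation base of the class `C`. -/
def AmalgBase (C : Set (Str L)) (A : Str L) : Prop := A ∈ C ∧ AmalgamatesOver C A

/-- The cofinal amalgamation property. -/
def CoAP (C : Set (Str L)) : Prop :=
  ∀ A ∈ C, ∃ A' : Str L, AmalgBase C A' ∧ Embeds A A'

/-! ### Computable ages -/

/-- An (abstract) enumerated age: for each index `i`, a generating tuple `tup i` and the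
structure `str i` it generates. -/
structure CompAge (L : Lang) where
  tup : ℕ → List ℕ
  str : ℕ → Str L
  tup_mem : ∀ i, TupleIn (str i) (tup i)
  gen : ∀ i x, x ∈ (str i).dom ↔ InClosure (str i) (tup i) x

/-- The class of structures represented by the enumerated age `K`. -/
def CompAge.cls (K : CompAge L) : Set (Str L) := { B | ∃ i, Isom B (K.str i) }

/-- The structure `M` is computable in the oracle set `s`. -/
def StrComputableIn (s : Set ℕ) (M : Str L) : Prop :=
  SetRecIn s M.dom ∧
  SetRecIn s { p | ∃ r as, TupleIn M as ∧ M.rel r as ∧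
      p = Nat.pair r (Encodable.encode as) } ∧
  SetRecIn s { p | ∃ f as b, L.funArity f = some as.length ∧ TupleIn M as ∧
      M.fn f as = b ∧ p = Nat.pair f (Nat.pair (Encodable.encode as) b) }

/-- The coded diagram of an enumerated age. -/
def CompAge.diag (K : CompAge L) : Set ℕ :=
  { p | ∃ i, p = Nat.pair 0 (Nat.pair i (Encodable.encode (K.tup i))) } ∪
  { p | ∃ i x, x ∈ (K.str i).dom ∧ p = Nat.pair 1 (Nat.pair i x) } ∪
  { p | ∃ i r as, TupleIn (K.str i) as ∧ (K.str i).rel r as ∧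
      p = Nat.pair 2 (Nat.pair i (Nat.pair r (Encodable.encode as))) } ∪
  { p | ∃ i r as, TupleIn (K.str i) as ∧ L.relArity r = some as.length ∧
      ¬ (K.str i).rel r as ∧
      p = Nat.pair 3 (Nat.pair i (Nat.pair r (Encodable.encode as))) } ∪
  { p | ∃ i f as b, TupleIn (K.str i) as ∧ L.funArity f = some as.length ∧
      (K.str i).fn f as = b ∧
      p = Nat.pair 4 (Nat.pair i (Nat.pair f (Nat.pair (Encodable.encode as) b))) }

/-- `K` is an `s`-computable age: its diagram is c.e. in `s` and each of its structures
is computable in `s`. -/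
def AgeComputableIn (s : Set ℕ) (K : CompAge L) : Prop :=
  CEIn s K.diag ∧ ∀ i, StrComputableIn s (K.str i)

/-- The embedding information of an enumerated age, as a set of naturals. -/
def EmbedInfo (K : CompAge L) : Set ℕ :=
  { p | ∃ k₀ b₀ k₁ b₁, TupleIn (K.str k₀) b₀ ∧ TupleIn (K.str k₁) b₁ ∧
      ClSim (K.str k₀) b₀ (K.str k₁) b₁ ∧
      p = Nat.pair k₀ (Nat.pair (Encodable.encode b₀)
            (Nat.pair k₁ (Encodable.encode b₁))) }

/-! ### Potential embeddings, spans, and amalgamation diagrams -/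

/-- A potential embedding: a pair of indices and a tuple in the codomain structure. -/
structure PotEmb where
  i : ℕ
  j : ℕ
  c : List ℕ

/-- A numerical code of a potential embedding. -/
def PotEmb.code (F : PotEmb) : ℕ :=
  Nat.pair F.i (Nat.pair F.j (Encodable.encode F.c))

/-- The potential embedding is well-formed with respect to `K`. -/
def PotEmb.Valid (K : CompAge L) (F : PotEmb) : Prop :=
  F.c.length = (K.tup F.i).length ∧ TupleIn (K.str F.j) F.c

/-- The potential embedding is an embedding. -/
def PotEmb.IsEmb (K : CompAge L) (F : PotEmb) : Prop :=
  ClSim (K.str F.i) (K.tup F.i) (K.str F.j) F.c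

/-- The potential embedding is an isomorphism (its range generates the codomain). -/
def PotEmb.IsIso (K : CompAge L) (F : PotEmb) : Prop :=
  F.IsEmb K ∧ ∀ x ∈ (K.str F.j).dom, InClosure (K.str F.j) F.c x

/-- `h` realizes the potential embedding `F` as a map on the domain structure. -/
def ExtMap (K : CompAge L) (F : PotEmb) (h : ℕ → ℕ) : Prop :=
  (K.tup F.i).map h = F.c ∧ IsEmbMap (K.str F.i) (K.str F.j) h

/-- `(F₀, F₁)` is a potential span. -/
def PotSpan (K : CompAge L) (F₀ F₁ : PotEmb) : Prop :=
  F₀.Valid K ∧ F₁.Valid K ∧ F₀.i = F₁.i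

/-- `(G₀, G₁)` is an amalgamation diagram over the potential span `(F₀, F₁)`. -/
def AmalgDiagOver (K : CompAge L) (F₀ F₁ G₀ G₁ : PotEmb) : Prop :=
  G₀.Valid K ∧ G₁.Valid K ∧ G₀.IsEmb K ∧
  G₀.i = F₀.j ∧ G₁.i = F₁.j ∧ G₀.j = G₁.j ∧
  (F₀.IsEmb K → F₁.IsEmb K → G₁.IsEmb K ∧
    ∀ h₀ h₁ : ℕ → ℕ, ExtMap K G₀ h₀ → ExtMap K G₁ h₁ →
      F₀.c.map h₀ = F₁.c.map h₁)

/-- `H` is the composition `F ∘ G` of potential embeddings (where `F` is an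
embedding realized by any `h` extending it). -/
def CompRel (K : CompAge L) (F G H : PotEmb) : Prop :=
  G.j = F.i ∧ H.i = G.i ∧ H.j = F.j ∧
  ∀ h : ℕ → ℕ, ExtMap K F h → H.c = G.c.map h

/-! ### Computable versions of HP, JEP, AP, coAP -/

/-- The `s`-computable hereditary property. -/
def CHP (s : Set ℕ) (K : CompAge L) : Prop :=
  ∃ c : OCode, ∀ i (b : List ℕ), TupleIn (K.str i) b →
    ∃ j, OCode.eval (chi s) c (Nat.pair i (Encodable.encode b)) = Part.some j ∧
      ClSim (K.str j) (K.tup j) (K.str i) b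

/-- The `s`-computable joint embedding property. -/
def CJEP (s : Set ℕ) (K : CompAge L) : Prop :=
  ∃ c : OCode, ∀ i j : ℕ, ∃ F G : PotEmb,
    OCode.eval (chi s) c (Nat.pair i j) = Part.some (Nat.pair F.code G.code) ∧
    F.Valid K ∧ G.Valid K ∧ F.IsEmb K ∧ G.IsEmb K ∧
    F.i = i ∧ G.i = j ∧ F.j = G.j

/-- The `s`-computable amalgamation property. -/
def CAP (s : Set ℕ) (K : CompAge L) : Prop :=
  ∃ c : OCode, ∀ F₀ F₁ : PotEmb, PotSpan K F₀ F₁ →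
    ∃ G₀ G₁ : PotEmb,
      OCode.eval (chi s) c (Nat.pair F₀.code F₁.code) =
        Part.some (Nat.pair G₀.code G₁.code) ∧
      AmalgDiagOver K F₀ F₁ G₀ G₁

/-- A family `W` of distinguished embeddings with amalgamation-base codomains, closed
under pre/post composition with isomorphisms, covering all domains. -/
def IsCoAPFamily (K : CompAge L) (W : Set PotEmb) : Prop :=
  (∀ F ∈ W, F.Valid K ∧ F.IsEmb K ∧ AmalgBase K.cls (K.str F.j)) ∧
  (∀ F ∈ W, ∀ G H : PotEmb, G.Valid K → G.IsIso K → G.j = F.i →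
      CompRel K F G H → H ∈ W) ∧
  (∀ F ∈ W, ∀ G H : PotEmb, G.Valid K → G.IsIso K → G.i = F.j →
      CompRel K G F H → H ∈ W) ∧
  (∀ i : ℕ, ∃ F ∈ W, F.i = i)

/-- The `s`-computable cofinal amalgamation property: there is an `s`-c.e. family of
distinguished embeddings onto amalgamation bases together with an `s`-computable
amalgamation function. -/
def CcoAP (s : Set ℕ) (K : CompAge L) : Prop :=
  ∃ W : Set PotEmb, IsCoAPFamily K W ∧
    CEIn s { p | ∃ F ∈ W, p = F.code } ∧
    ∃ c : OCode, ∀ F ∈ W, ∀ G₀ G₁ : PotEmb,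
      G₀.Valid K → G₁.Valid K → G₀.i = F.j → G₁.i = F.j →
      ∃ D₀ D₁ : PotEmb,
        OCode.eval (chi s) c (Nat.pair F.code (Nat.pair G₀.code G₁.code)) =
          Part.some (Nat.pair D₀.code D₁.code) ∧
        AmalgDiagOver K G₀ G₁ D₀ D₁

/-! ### Ultrahomogeneity -/

/-- `M` is ultrahomogeneous: every isomorphism between finitely generated substructures
extends to an automorphism. -/
def Ultrahomogeneous (M : Str L) : Prop :=
  ∀ as bs : List ℕ, TupleIn M as → TupleIn M bs → ClSim M as M bs →
    ∃ g : ℕ → ℕ, IsAutoOf M g ∧ as.map g = bs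

/-- `g` is a bijection of the underlying set of `M` with itself. -/
def BijOnDom (M : Str L) (g : ℕ → ℕ) : Prop :=
  (∀ x ∈ M.dom, g x ∈ M.dom) ∧
  (∀ x ∈ M.dom, ∀ y ∈ M.dom, g x = g y → x = y) ∧
  (∀ y ∈ M.dom, ∃ x ∈ M.dom, g x = y)

/-- `M` is `s`-computably ultrahomogeneous. -/
def CompUltrahom (s : Set ℕ) (M : Str L) : Prop :=
  ∃ c : OCode, ∀ as bs : List ℕ, TupleIn M as → TupleIn M bs →
    as.length = bs.length →
    ∃ e : ℕ,
      OCode.eval (chi s) c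
          (Nat.pair (Encodable.encode as) (Encodable.encode bs)) = Part.some e ∧
      ∃ c' : OCode, c'.encodeCode = e ∧ ∃ g : ℕ → ℕ, ComputesIn s c' g ∧
        BijOnDom M g ∧
        (ClSim M as M bs → IsAutoOf M g ∧ as.map g = bs)

/-! ### Cofinal ultrahomogeneity -/

/-- `M` is cofinally ultrahomogeneous. -/
def CofinallyUltrahomogeneous (M : Str L) : Prop :=
  ∀ as : List ℕ, TupleIn M as → ∃ bs : List ℕ, TupleIn M bs ∧
    (∀ x ∈ as, InClosure M bs x) ∧
    ∀ cs : List ℕ, TupleIn M cs → ClSim M bs M cs →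
      ∃ g : ℕ → ℕ, IsAutoOf M g ∧ bs.map g = cs

/-- `E` is a cofinal collection of tuples in `M`. -/
def IsCofinalCollection (M : Str L) (E : Set (List ℕ)) : Prop :=
  (∀ bs ∈ E, TupleIn M bs) ∧
  (∀ as : List ℕ, TupleIn M as → ∃ bs ∈ E, ∀ x ∈ as, InClosure M bs x) ∧
  (∀ bs ∈ E, ∀ as : List ℕ, (∀ x ∈ as, InClosure M bs x) → (as ++ bs) ∈ E) ∧
  (∀ as ∈ E, ∀ bs : List ℕ, TupleIn M bs → ClSim M as M bs → bs ∈ E)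

/-- `M` is cofinally ultrahomogeneous for the collection `E`: every isomorphism between
substructures generated by members of `E` extends to an automorphism. -/
def CofUltraFor (M : Str L) (E : Set (List ℕ)) : Prop :=
  ∀ as ∈ E, ∀ bs ∈ E, ClSim M as M bs →
    ∃ g : ℕ → ℕ, IsAutoOf M g ∧ as.map g = bs

/-- The set of codes of members of `E`. -/
def ECodes (E : Set (List ℕ)) : Set ℕ := { p | ∃ as ∈ E, p = Encodable.encode as }

/-- The functional part of `s`-computable cofinal ultrahomogeneity with respect to `E`. -/
def CofUltraFunIn (s : Set ℕ) (M : Str L) (E : Set (List ℕ)) : Prop :=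
  ∃ c : OCode, ∀ as ∈ E, ∀ bs : List ℕ, TupleIn M bs → TupleSim as bs →
    ∃ e : ℕ,
      OCode.eval (chi s) c
          (Nat.pair (Encodable.encode as) (Encodable.encode bs)) = Part.some e ∧
      ∃ c' : OCode, c'.encodeCode = e ∧ ∃ g : ℕ → ℕ, ComputesIn s c' g ∧
        BijOnDom M g ∧ as.map g = bs ∧
        (ClSim M as M bs → IsAutoOf M g)

/-- `M` is `s`-computably cofinally ultrahomogeneous with respect to `E`. -/
def CompCofUltrahomWrt (s : Set ℕ) (M : Str L) (E : Set (List ℕ)) : Prop :=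
  IsCofinalCollection M E ∧ SetRecIn s (ECodes E) ∧ CofUltraFunIn s M E

/-- `M` is `s`-computably cofinally ultrahomogeneous. -/
def CompCofUltrahom (s : Set ℕ) (M : Str L) : Prop :=
  ∃ E : Set (List ℕ), CompCofUltrahomWrt s M E

/-- The `s`-computable cofinal extension property with respect to `E`. -/
def CompCofExtProp (s : Set ℕ) (M : Str L) (E : Set (List ℕ)) : Prop :=
  ∃ c : OCode, ∀ as bs cs : List ℕ, as ∈ E → cs ∈ E → TupleIn M bs →
    (∀ x ∈ as, InClosure M cs x) → TupleSim as bs →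
    ∃ ds : List ℕ,
      OCode.eval (chi s) c
          (Nat.pair (Encodable.encode as)
            (Nat.pair (Encodable.encode bs) (Encodable.encode cs))) =
        Part.some (Encodable.encode ds) ∧
      TupleIn M ds ∧ TupleSim (as ++ cs) (bs ++ ds) ∧
      (ClSim M as M bs →
        ClSim M ds M cs ∧ (∀ x ∈ bs, InClosure M ds x) ∧
        ∀ h h' : ℕ → ℕ,
          ds.map h = cs → IsIsoMap (M.sub ds) (M.sub cs) h →
          bs.map h' = as → IsIsoMap (M.sub bs) (M.sub as) h' →
          bs.map h = bs.map h')

/-! ### Canonical ages and limits -/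

/-- `K` is a canonical age of `M` (relative to the oracle `t`): the enumeration of
generating tuples is `t`-computable, lists every finite tuple of `M` infinitely often,
and `str i` is the substructure generated by `tup i`. -/
def IsCanonicalAgeOf (t : Set ℕ) (K : CompAge L) (M : Str L) : Prop :=
  TotalComputableIn t (fun i => Encodable.encode (K.tup i)) ∧
  (∀ i, TupleIn M (K.tup i)) ∧
  (∀ as : List ℕ, TupleIn M as → ∀ n : ℕ, ∃ i, n ≤ i ∧ K.tup i = as) ∧
  (∀ i, K.str i = M.sub (K.tup i))

/-- `K` represents the age of `M`. -/
def RepresentsAgeOf (K : CompAge L) (M : Str L) : Prop :=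
  (∀ i, AgeMemOf M (K.str i)) ∧
  (∀ B : Str L, AgeMemOf M B → ∃ i, Isom B (K.str i))

/-- `M` is a cofinal Fraïssé limit of (the age represented by) `K`. -/
def CofinalFraisseLimitOf (K : CompAge L) (M : Str L) : Prop :=
  CofinallyUltrahomogeneous M ∧ RepresentsAgeOf K M

/-- The enumerated age `K` is uniformly finite. -/
def UniformlyFinite (K : CompAge L) : Prop :=
  L.FiniteLang ∧ ∃ f : ℕ → ℕ, TotalComputableIn ∅ f ∧
    ∀ i, ∀ as : List ℕ, TupleIn (K.str i) as →
      { x | InClosure (K.str i) as x }.Finite ∧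
      { x | InClosure (K.str i) as x }.ncard ≤ f as.length

section Support

/-! ### Typed functions and predicates computable in an oracle -/

theorem OCode.eval_comp {O : ℕ →. ℕ} {c d : OCode} {n m : ℕ}
    (h : OCode.eval O d n = Part.some m) :
    OCode.eval O (OCode.comp c d) n = OCode.eval O c m := by
  simp only [OCode.eval, h]
  exact Part.bind_some _ _

theorem OCode.eval_pair {O : ℕ →. ℕ} {c d : OCode} {n a b : ℕ}
    (hc : OCode.eval O c n = Part.some a) (hd : OCode.eval O d n = Part.some b) :
    OCode.eval O (OCode.pair c d) n = Part.some (Nat.pair a b) := by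
  simp [OCode.eval, hc, hd, Seq.seq]

theorem OCode.eval_prec {O : ℕ →. ℕ} {c d : OCode} {a n : ℕ} {f : ℕ → ℕ}
    (h0 : OCode.eval O c a = Part.some (f 0))
    (hs : ∀ y, OCode.eval O d (Nat.pair a (Nat.pair y (f y))) = Part.some (f (y + 1))) :
    OCode.eval O (OCode.prec c d) (Nat.pair a n) = Part.some (f n) := by
  simp only [OCode.eval, Nat.unpaired, Nat.unpair_pair]
  induction n with
  | zero => simpa using h0
  | succ n ih =>
    simp only at ih ⊢
    rw [ih]
    simpa using hs n

theorem OCode.mem_eval_rfind {O : ℕ →. ℕ} {c : OCode} {a : ℕ} {f : ℕ → ℕ}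
    (h : ∀ n, OCode.eval O c (Nat.pair a n) = Part.some (f n)) (m : ℕ) :
    m ∈ OCode.eval O (OCode.rfind' c) (Nat.pair a 0) ↔ f m = 0 ∧ ∀ k < m, f k ≠ 0 := by
  simp only [OCode.eval, Nat.unpaired, Nat.unpair_pair, h, add_zero, Part.map_eq_map,
    Part.map_some]
  exact Nat.mem_rfind.trans (by simp)

theorem OCode.eval_rfind_dom {O : ℕ →. ℕ} {c : OCode} {a : ℕ} {f : ℕ → ℕ}
    (h : ∀ n, OCode.eval O c (Nat.pair a n) = Part.some (f n)) :
    (OCode.eval O (OCode.rfind' c) (Nat.pair a 0)).Dom ↔ ∃ n, f n = 0 := by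
  rw [Part.dom_iff_mem]
  constructor
  · rintro ⟨m, hm⟩
    exact ⟨m, ((OCode.mem_eval_rfind h m).1 hm).1⟩
  · intro hn
    exact ⟨Nat.find hn, (OCode.mem_eval_rfind h _).2
      ⟨Nat.find_spec hn, fun k hk => Nat.find_min hn hk⟩⟩

theorem OCode.encodeCode_injective : Function.Injective OCode.encodeCode := by
  intro c
  induction c with
  | pair a b iha ihb | comp a b iha ihb | prec a b iha ihb =>
    intro d h
    cases d <;> simp only [OCode.encodeCode] at h <;> first
      | omega
      | (obtain ⟨h1, h2⟩ := Nat.pair_eq_pair.1 (Nat.eq_of_mul_eq_mul_left (by decide : 0 < 4)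
           (Nat.add_right_cancel h))
         rw [iha h1, ihb h2])
  | rfind' a iha =>
    intro d h
    cases d <;> simp only [OCode.encodeCode] at h <;> first
      | omega
      | rw [iha (Nat.eq_of_mul_eq_mul_left (by decide : 0 < 4) (Nat.add_right_cancel h))]
  | _ =>
    intro d h
    cases d <;> simp only [OCode.encodeCode] at h <;> first
      | rfl
      | omega

theorem mem_jump_iff {O : Set ℕ} {c : OCode} {n : ℕ} :
    Nat.pair c.encodeCode n ∈ jump O ↔ (OCode.eval (chi O) c n).Dom := by
  simp only [jump, Set.mem_ofPred_eq, Nat.unpair_pair]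
  constructor
  · rintro ⟨d, hd, h⟩
    rwa [← OCode.encodeCode_injective hd]
  · exact fun h => ⟨c, rfl, h⟩

theorem exists_code_of_natPrimrec (O : ℕ →. ℕ) {f : ℕ → ℕ} (hf : Nat.Primrec f) :
    ∃ c : OCode, ∀ n, OCode.eval O c n = Part.some (f n) := by
  induction hf with
  | zero => exact ⟨.zero, fun n => rfl⟩
  | succ => exact ⟨.succ, fun n => rfl⟩
  | left => exact ⟨.left, fun n => rfl⟩
  | right => exact ⟨.right, fun n => rfl⟩
  | pair _ _ ihf ihg =>
    obtain ⟨c, hc⟩ := ihf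
    obtain ⟨d, hd⟩ := ihg
    exact ⟨.pair c d, fun n => OCode.eval_pair (hc n) (hd n)⟩
  | comp _ _ ihf ihg =>
    obtain ⟨c, hc⟩ := ihf
    obtain ⟨d, hd⟩ := ihg
    exact ⟨.comp c d, fun n => by rw [OCode.eval_comp (hd n), hc]⟩
  | @prec f g _ _ ihf ihg =>
    obtain ⟨c, hc⟩ := ihf
    obtain ⟨d, hd⟩ := ihg
    refine ⟨.prec c d, fun n => ?_⟩
    obtain ⟨a, m, rfl⟩ : ∃ a m, n = Nat.pair a m := ⟨_, _, (Nat.pair_unpair n).symm⟩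
    have := OCode.eval_prec (O := O) (c := c) (d := d) (a := a) (n := m)
      (f := fun m => m.rec (f a) fun y IH => g (Nat.pair a (Nat.pair y IH)))
      (by simpa using hc a) (fun y => by simpa using hd _)
    simpa using this

section

variable {α β γ σ : Type*} [Primcodable α] [Primcodable β] [Primcodable γ] [Primcodable σ]

/-- `f` is a total function between coded types, computable in the oracle set `O`. -/
def CompIn (O : Set ℕ) (f : α → β) : Prop :=
  ∃ c : OCode, ∀ a, OCode.eval (chi O) c (Encodable.encode a) = Part.some (Encodable.encode (f a))

/-- `p` is a predicate on a coded type, decidable in the oracle set `O`. -/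
def DecIn (O : Set ℕ) (p : α → Prop) : Prop :=
  CompIn O (fun a => if p a then 1 else 0)

variable {O : Set ℕ}

theorem CompIn.of_eq {f g : α → β} (hf : CompIn O f) (h : ∀ a, f a = g a) : CompIn O g :=
  funext h ▸ hf

theorem CompIn.comp {f : β → γ} {g : α → β} (hf : CompIn O f) (hg : CompIn O g) :
    CompIn O (fun a => f (g a)) := by
  obtain ⟨c, hc⟩ := hf
  obtain ⟨d, hd⟩ := hg
  exact ⟨.comp c d, fun a => by rw [OCode.eval_comp (hd a), hc]⟩

theorem CompIn.pair {f : α → β} {g : α → γ} (hf : CompIn O f) (hg : CompIn O g) :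
    CompIn O (fun a => (f a, g a)) := by
  obtain ⟨c, hc⟩ := hf
  obtain ⟨d, hd⟩ := hg
  exact ⟨.pair c d, fun a => by rw [OCode.eval_pair (hc a) (hd a), Encodable.encode_prod_val]⟩

theorem CompIn.of_primrec {f : α → β} (hf : Primrec f) : CompIn O f := by
  obtain ⟨c, hc⟩ := exists_code_of_natPrimrec (chi O) (Nat.Primrec.pred.comp hf)
  exact ⟨c, fun a => by simp [hc]⟩

theorem CompIn.nat_rec {f : α → σ} {g : α × ℕ × σ → σ} (hf : CompIn O f) (hg : CompIn O g) :
    CompIn O (fun p : α × ℕ =>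
      (Nat.rec (f p.1) (fun y ih => g (p.1, y, ih)) p.2 : σ)) := by
  obtain ⟨c, hc⟩ := hf
  obtain ⟨d, hd⟩ := hg
  refine ⟨.prec c d, fun ⟨a, n⟩ => ?_⟩
  rw [Encodable.encode_prod_val]
  exact OCode.eval_prec (f := fun n => Encodable.encode
    (Nat.rec (f a) (fun y ih => g (a, y, ih)) n : σ)) (hc a) (fun y => by
      simpa [Encodable.encode_prod_val] using hd (a, y, _))

theorem DecIn.of_iff {p q : α → Prop} (hp : DecIn O p) (h : ∀ a, p a ↔ q a) : DecIn O q :=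
  (funext fun a => propext (h a) : p = q) ▸ hp

theorem DecIn.comp {p : β → Prop} {f : α → β} (hp : DecIn O p) (hf : CompIn O f) :
    DecIn O (fun a => p (f a)) :=
  CompIn.comp (f := fun b => if p b then 1 else 0) hp hf

theorem DecIn.comp_primrec {p : β → Prop} {f : α → β} (hp : DecIn O p) (hf : Primrec f) :
    DecIn O (fun a => p (f a)) :=
  hp.comp (.of_primrec hf)

theorem DecIn.of_primrecPred {p : α → Prop} (hp : PrimrecPred p) : DecIn O p :=
  CompIn.of_primrec (Primrec.ite hp (Primrec.const 1) (Primrec.const 0))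

theorem DecIn.not {p : α → Prop} (hp : DecIn O p) : DecIn O (fun a => ¬ p a) :=
  (CompIn.comp (f := fun n : ℕ => 1 - n)
    (.of_primrec (Primrec.nat_sub.comp (Primrec.const 1) Primrec.id)) hp).of_eq
    fun a => by by_cases h : p a <;> simp [h]

theorem DecIn.and {p q : α → Prop} (hp : DecIn O p) (hq : DecIn O q) :
    DecIn O (fun a => p a ∧ q a) :=
  (CompIn.comp (f := fun n : ℕ × ℕ => n.1 * n.2)
    (.of_primrec (Primrec.nat_mul.comp Primrec.fst Primrec.snd)) (CompIn.pair hp hq)).of_eq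
    fun a => by by_cases h : p a <;> by_cases h' : q a <;> simp [h, h']

theorem DecIn.or {p q : α → Prop} (hp : DecIn O p) (hq : DecIn O q) :
    DecIn O (fun a => p a ∨ q a) :=
  (hp.not.and hq.not).not.of_iff fun a => by tauto

theorem DecIn.imp {p q : α → Prop} (hp : DecIn O p) (hq : DecIn O q) :
    DecIn O (fun a => p a → q a) :=
  (hp.not.or hq).of_iff fun a => by tauto

theorem DecIn.iff {p q : α → Prop} (hp : DecIn O p) (hq : DecIn O q) :
    DecIn O (fun a => p a ↔ q a) :=
  ((hp.imp hq).and (hq.imp hp)).of_iff fun a => by tauto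

theorem DecIn.forall_lt {p : α × ℕ → Prop} (hp : DecIn O p) :
    DecIn O (fun a : α × ℕ => ∀ i < a.2, p (a.1, i)) := by
  have h := CompIn.nat_rec (O := O) (f := fun _ : α => 1)
    (g := fun t : α × ℕ × ℕ => t.2.2 * if p (t.1, t.2.1) then 1 else 0)
    (.of_primrec (Primrec.const 1))
    (CompIn.comp (f := fun n : ℕ × ℕ => n.1 * n.2)
      (.of_primrec (Primrec.nat_mul.comp Primrec.fst Primrec.snd))
      (CompIn.pair (.of_primrec (Primrec.snd.comp Primrec.snd))
        (hp.comp_primrec (Primrec.fst.pair (Primrec.fst.comp Primrec.snd)))))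
  refine h.of_eq fun ⟨a, n⟩ => ?_
  dsimp only
  induction n with
  | zero => simp
  | succ n ih =>
    simp only [Nat.forall_lt_succ_right] at ih ⊢
    rw [ih]
    by_cases h1 : ∀ i < n, p (a, i) <;> by_cases h2 : p (a, n) <;> simp [h1, h2]

theorem DecIn.forall_mem_list [Inhabited β] {p : β → Prop} (hp : DecIn O p) :
    DecIn O (fun l : List β => ∀ x ∈ l, p x) := by
  have h := DecIn.forall_lt (O := O) (p := fun t : List β × ℕ => p (t.1.getD t.2 default))
    (hp.comp_primrec (Primrec.list_getD default))
  refine (h.comp_primrec (f := fun l : List β => (l, l.length))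
    (Primrec.id.pair Primrec.list_length)).of_iff fun l => ?_
  simp only [List.forall_mem_iff_getElem]
  refine forall_congr' fun i => forall_congr' fun hi => ?_
  rw [List.getD_eq_getElem _ _ hi]

theorem primrec_decode_getD [Inhabited β] :
    Primrec (fun n : ℕ => (Encodable.decode n : Option β).getD default) :=
  Primrec.option_getD.comp Primrec.decode (Primrec.const default)

/-- An unbounded search through a coded type for a witness to a decidable relation. -/
theorem DecIn.exists_code_search [Inhabited β] {p : α × β → Prop} (hp : DecIn O p) :
    ∃ c : OCode, ∀ a, ((OCode.eval (chi O) c (Encodable.encode a)).Dom ↔ ∃ b, p (a, b)) ∧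
      ∀ m ∈ OCode.eval (chi O) c (Encodable.encode a),
        p (a, (Encodable.decode m : Option β).getD default) := by
  obtain ⟨c, hc⟩ : DecIn O fun t : α × ℕ =>
      ¬ p (t.1, (Encodable.decode t.2 : Option β).getD default) :=
    (hp.comp_primrec (Primrec.fst.pair (primrec_decode_getD.comp Primrec.snd))).not
  obtain ⟨e, he⟩ : CompIn O fun a : α => (a, 0) :=
    .of_primrec (Primrec.id.pair (Primrec.const 0))
  have hr : ∀ a : α, ∀ n, OCode.eval (chi O) c (Nat.pair (Encodable.encode a) n) = Part.some
      (if p (a, (Encodable.decode n : Option β).getD default) then 0 else 1) := fun a n => by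
    have := hc (a, n)
    by_cases h : p (a, (Encodable.decode n : Option β).getD default) <;>
      simpa [Encodable.encode_prod_val, h] using this
  refine ⟨.comp (.rfind' c) e, fun a => ?_⟩
  rw [OCode.eval_comp (he a), Encodable.encode_prod_val]
  refine ⟨?_, fun m hm => ?_⟩
  · rw [Encodable.encode_nat, OCode.eval_rfind_dom (hr a)]
    constructor
    · rintro ⟨n, hn⟩
      exact ⟨_, by simpa using hn⟩
    · rintro ⟨b, hb⟩
      exact ⟨Encodable.encode b, by simpa using hb⟩
  · simpa using ((OCode.mem_eval_rfind (hr a) m).1 hm).1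

theorem DecIn.exists_jump [Inhabited β] {p : α × β → Prop} (hp : DecIn O p) :
    DecIn (jump O) (fun a => ∃ b, p (a, b)) := by
  obtain ⟨c, hc⟩ := hp.exists_code_search
  obtain ⟨d, hd⟩ := exists_code_of_natPrimrec (chi (jump O))
    ((Nat.Primrec.const c.encodeCode).pair Nat.Primrec.id)
  refine ⟨.comp .oracle d, fun a => ?_⟩
  rw [OCode.eval_comp (hd _)]
  simp [OCode.eval, chi, mem_jump_iff, (hc a).1]

theorem DecIn.forall_jump [Inhabited β] {p : α × β → Prop} (hp : DecIn O p) :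
    DecIn (jump O) (fun a => ∀ b, p (a, b)) :=
  hp.not.exists_jump.not.of_iff fun a => by simp

theorem DecIn.to_jump {p : α → Prop} (hp : DecIn O p) : DecIn (jump O) p :=
  (DecIn.exists_jump (β := ℕ) (hp.comp_primrec (f := fun t : α × ℕ => t.1) Primrec.fst)).of_iff
    fun a => by simp

theorem DecIn.exists_choice [Inhabited β] {p : α × β → Prop} (hp : DecIn O p)
    (h : ∀ a, ∃ b, p (a, b)) : ∃ f : α → β, CompIn O f ∧ ∀ a, p (a, f a) := by
  obtain ⟨c, hc⟩ := hp.exists_code_search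
  obtain ⟨d, hd⟩ : CompIn O fun n : ℕ => (Encodable.decode n : Option β).getD default :=
    .of_primrec primrec_decode_getD
  have hdom : ∀ a, (OCode.eval (chi O) c (Encodable.encode a)).Dom := fun a => (hc a).1.2 (h a)
  refine ⟨fun a => (Encodable.decode
    ((OCode.eval (chi O) c (Encodable.encode a)).get (hdom a)) : Option β).getD default,
    ⟨.comp d c, fun a => ?_⟩, fun a => (hc a).2 _ (Part.get_mem _)⟩
  rw [OCode.eval_comp (Part.some_get (hdom a)).symm]
  exact hd _

theorem SetRecIn.decIn {A : Set ℕ} (h : SetRecIn O A) : DecIn O (fun n => n ∈ A) := by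
  obtain ⟨c, hc⟩ := h
  exact ⟨c, fun n => by simp [hc, chi]⟩

theorem DecIn.setRecIn {A : Set ℕ} (h : DecIn O (fun n => n ∈ A)) : SetRecIn O A := by
  obtain ⟨c, hc⟩ := h
  exact ⟨c, funext fun n => by simpa [chi] using hc n⟩

/-- The parameter theorem. -/
theorem CompIn.exists_index {f : α × ℕ → ℕ} (hf : CompIn O f) :
    ∃ e : α → OCode, CompIn O (fun a => (e a).encodeCode) ∧
      ∀ a, ComputesIn O (e a) (fun x => f (a, x)) := by
  obtain ⟨c, hc⟩ := hf
  let num : ℕ → OCode := fun n => n.rec .zero fun _ d => .comp .succ d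
  have hnum : ∀ k n, OCode.eval (chi O) (num k) n = Part.some k := by
    intro k n
    induction k with
    | zero => rfl
    | succ k ih => exact OCode.eval_comp ih
  have hnum' : Primrec fun n => (num n).encodeCode := by
    have : Primrec (fun n : ℕ => (Nat.rec 0
        (fun _ ih => 4 * Nat.pair 1 ih + 6) n : ℕ)) :=
      Primrec.nat_rec₁ 0 ((Primrec.nat_add.comp (Primrec.nat_mul.comp (Primrec.const 4)
        (Primrec₂.natPair.comp (Primrec.const 1) Primrec.snd)) (Primrec.const 6)).to₂)
    refine this.of_eq fun n => ?_
    induction n with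
    | zero => rfl
    | succ n ih => simp only [num, OCode.encodeCode] at ih ⊢; rw [ih]
  refine ⟨fun a => .comp c (.pair (num (Encodable.encode a)) (.pair .left .right)),
    .of_primrec ?_, fun a x => ?_⟩
  · simp only [OCode.encodeCode]
    exact Primrec.nat_add.comp (Primrec.nat_mul.comp (Primrec.const 4)
      (Primrec₂.natPair.comp (Primrec.const _) (Primrec.nat_add.comp
        (Primrec.nat_mul.comp (Primrec.const 4) (Primrec₂.natPair.comp
          (hnum'.comp Primrec.encode) (Primrec.const _))) (Primrec.const 5)))) (Primrec.const 6)
  · have h1 : OCode.eval (chi O) (.pair .left .right) x = Part.some x := by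
      rw [OCode.eval_pair (a := x.unpair.1) (b := x.unpair.2) rfl rfl, Nat.pair_unpair]
    rw [OCode.eval_comp (OCode.eval_pair (hnum _ _) h1)]
    simpa [Encodable.encode_prod_val] using hc (a, x)

end

/-! ### Deciding whether a coordinatewise map generates an isomorphism -/

variable {M : Str L}

/-- The substructure of the square of `M` generated by a list of pairs. -/
inductive PairClosure (M : Str L) (l : List (ℕ × ℕ)) : ℕ × ℕ → Prop
  | base {p : ℕ × ℕ} : p ∈ l → PairClosure M l p
  | fn (f : ℕ) (ts : List (ℕ × ℕ)) : L.funArity f = some ts.length →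
      (∀ t ∈ ts, PairClosure M l t) →
      PairClosure M l (M.fn f (ts.map Prod.fst), M.fn f (ts.map Prod.snd))

theorem PairClosure.inClosure_fst {l : List (ℕ × ℕ)} (hl : TupleIn M (l.map Prod.fst))
    {p : ℕ × ℕ} (h : PairClosure M l p) : InClosure M (l.map Prod.fst) p.1 := by
  induction h with
  | base hp => exact .base (List.mem_map_of_mem hp) (hl _ (List.mem_map_of_mem hp))
  | fn f ts hf _ ih =>
    refine .fn f _ (by simpa using hf) fun x hx => ?_
    obtain ⟨t, ht, rfl⟩ := List.mem_map.1 hx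
    exact ih t ht

theorem PairClosure.inClosure_snd {l : List (ℕ × ℕ)} (hl : TupleIn M (l.map Prod.snd))
    {p : ℕ × ℕ} (h : PairClosure M l p) : InClosure M (l.map Prod.snd) p.2 := by
  induction h with
  | base hp => exact .base (List.mem_map_of_mem hp) (hl _ (List.mem_map_of_mem hp))
  | fn f ts hf _ ih =>
    refine .fn f _ (by simpa using hf) fun x hx => ?_
    obtain ⟨t, ht, rfl⟩ := List.mem_map.1 hx
    exact ih t ht

theorem InClosure.exists_pairClosure_fst {l : List (ℕ × ℕ)} {x : ℕ}
    (h : InClosure M (l.map Prod.fst) x) : ∃ y, PairClosure M l (x, y) := by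
  induction h with
  | base hx _ =>
    obtain ⟨⟨x, y⟩, ht, rfl⟩ := List.mem_map.1 hx
    exact ⟨y, .base ht⟩
  | fn f as hf _ ih =>
    choose! k hk using ih
    have := PairClosure.fn (M := M) (l := l) f (as.map fun x => (x, k x)) (by simpa using hf)
      (by simpa using hk)
    exact ⟨_, by simpa [Function.comp_def] using this⟩

theorem InClosure.exists_pairClosure_snd {l : List (ℕ × ℕ)} {y : ℕ}
    (h : InClosure M (l.map Prod.snd) y) : ∃ x, PairClosure M l (x, y) := by
  induction h with
  | base hx _ =>
    obtain ⟨⟨x, y⟩, ht, rfl⟩ := List.mem_map.1 hx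
    exact ⟨x, .base ht⟩
  | fn f as hf _ ih =>
    choose! k hk using ih
    have := PairClosure.fn (M := M) (l := l) f (as.map fun y => (k y, y)) (by simpa using hf)
      (by simpa using hk)
    exact ⟨_, by simpa [Function.comp_def] using this⟩

/-- A coordinatewise map generates an isomorphism iff the substructure of the square it generates
is the graph of an injective function respecting all relations. -/
theorem clSim_iff_pairClosure {l : List (ℕ × ℕ)} (h₁ : TupleIn M (l.map Prod.fst))
    (h₂ : TupleIn M (l.map Prod.snd)) :
    ClSim M (l.map Prod.fst) M (l.map Prod.snd) ↔
      (∀ p q, PairClosure M l p → PairClosure M l q → (p.1 = q.1 ↔ p.2 = q.2)) ∧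
      ∀ r (ts : List (ℕ × ℕ)), (∀ t ∈ ts, PairClosure M l t) →
        (M.rel r (ts.map Prod.fst) ↔ M.rel r (ts.map Prod.snd)) := by
  constructor
  · rintro ⟨h, hmap, ⟨_, hinj, hrel, hfn⟩, _⟩
    have key : ∀ p, PairClosure M l p → h p.1 = p.2 := by
      intro p hp
      induction hp with
      | base hp =>
        rw [List.map_map, List.map_inj_left] at hmap
        exact hmap _ hp
      | fn f ts hf hts ih =>
        have := hfn f (ts.map Prod.fst) (by simpa using hf) (fun x hx => by
          obtain ⟨t, ht, rfl⟩ := List.mem_map.1 hx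
          exact (hts t ht).inClosure_fst h₁)
        refine Eq.trans this ?_
        rw [List.map_map, List.map_congr_left (f := h ∘ Prod.fst) (g := Prod.snd) ih]
        rfl
    refine ⟨fun p q hp hq => ⟨fun e => ?_, fun e => ?_⟩, fun r ts hts => ?_⟩
    · rw [← key p hp, ← key q hq, e]
    · exact hinj _ (hp.inClosure_fst h₁) _ (hq.inClosure_fst h₁) (by rw [key p hp, key q hq, e])
    · have hm : (ts.map Prod.fst).map h = ts.map Prod.snd := by
        rw [List.map_map, List.map_inj_left]
        exact fun t ht => key t (hts t ht)
      have h1 : ∀ x ∈ ts.map Prod.fst, InClosure M (l.map Prod.fst) x := fun x hx => by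
        obtain ⟨t, ht, rfl⟩ := List.mem_map.1 hx
        exact (hts t ht).inClosure_fst h₁
      have h2 : ∀ x ∈ ts.map Prod.snd, InClosure M (l.map Prod.snd) x := fun x hx => by
        obtain ⟨t, ht, rfl⟩ := List.mem_map.1 hx
        exact (hts t ht).inClosure_snd h₂
      have := hrel r (ts.map Prod.fst) h1
      rw [hm] at this
      exact ⟨fun hr => (this.1 ⟨hr, h1⟩).1, fun hr => (this.2 ⟨hr, h2⟩).1⟩
  · rintro ⟨hpq, hrel⟩
    have hex : ∀ x, InClosure M (l.map Prod.fst) x → ∃ y, PairClosure M l (x, y) :=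
      fun x hx => hx.exists_pairClosure_fst
    choose! h hh using hex
    have key : ∀ p, PairClosure M l p → h p.1 = p.2 := fun p hp =>
      (hpq _ _ (hh p.1 (hp.inClosure_fst h₁)) hp).1 rfl
    refine ⟨h, ?_, ⟨fun x hx => (hh x hx).inClosure_snd h₂, fun x hx y hy e => ?_,
      fun r as has => ?_, fun f as hf has => ?_⟩, fun y hy => ?_⟩
    · rw [List.map_map, List.map_inj_left]
      exact fun p hp => key p (.base hp)
    · exact (hpq _ _ (hh x hx) (hh y hy)).2 e
    · have := hrel r (as.map fun x => (x, h x)) (by simpa using fun x hx => hh x (has x hx))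
      simp only [List.map_map, Function.comp_def, List.map_id'] at this
      refine and_congr this (iff_of_true has fun x hx => ?_)
      obtain ⟨t, ht, rfl⟩ := List.mem_map.1 hx
      exact (hh t (has t ht)).inClosure_snd h₂
    · have := PairClosure.fn (M := M) (l := l) f (as.map fun x => (x, h x)) (by simpa using hf)
        (by simpa using fun x hx => hh x (has x hx))
      simp only [List.map_map, Function.comp_def, List.map_id'] at this
      exact key _ this
    · obtain ⟨x, hx⟩ := InClosure.exists_pairClosure_snd hy
      exact ⟨x, hx.inClosure_fst h₁, key _ hx⟩

/-- `b` is the value in `M` of the function symbol `f` at the tuple `as`. -/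
def FnGraph (M : Str L) (f : ℕ) (as : List ℕ) (b : ℕ) : Prop :=
  L.funArity f = some as.length ∧ TupleIn M as ∧ M.fn f as = b

/-- A step of a derivation: a function symbol, a list of argument pairs and a value pair. -/
abbrev DerivStep : Type := ℕ × List (ℕ × ℕ) × ℕ × ℕ

/-- The pairs available after the derivation `D` from `l`. -/
def derivPool (l : List (ℕ × ℕ)) (D : List DerivStep) : List (ℕ × ℕ) :=
  l ++ D.map fun e => e.2.2

/-- The step `e` is justified when the pairs in `pool` are available. -/
def StepOk (M : Str L) (pool : List (ℕ × ℕ)) (e : DerivStep) : Prop :=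
  (∀ t ∈ e.2.1, t ∈ pool) ∧ FnGraph M e.1 (e.2.1.map Prod.fst) e.2.2.1 ∧
    FnGraph M e.1 (e.2.1.map Prod.snd) e.2.2.2

/-- `D` is a derivation, latest step first, of members of the pair closure of `l`. -/
def DerivOk (M : Str L) (l : List (ℕ × ℕ)) : List DerivStep → Prop
  | [] => True
  | e :: D => StepOk M (derivPool l D) e ∧ DerivOk M l D

theorem derivOk_iff_forall_lt {l : List (ℕ × ℕ)} {D : List DerivStep} :
    DerivOk M l D ↔
      ∀ i < D.length, StepOk M (derivPool l (D.drop (i + 1))) (D.getD i default) := by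
  induction D with
  | nil => simp [DerivOk]
  | cons e D ih =>
    rw [DerivOk, ih, List.length_cons, Nat.forall_lt_succ_left]
    simp

theorem mem_derivPool_append {l : List (ℕ × ℕ)} {D D' : List DerivStep} {t : ℕ × ℕ} :
    t ∈ derivPool l (D ++ D') ↔ t ∈ derivPool l D ∨ t ∈ derivPool l D' := by
  simp only [derivPool, List.map_append, List.mem_append]
  tauto

theorem DerivOk.append {l : List (ℕ × ℕ)} {D D' : List DerivStep} (h : DerivOk M l D)
    (h' : DerivOk M l D') : DerivOk M l (D ++ D') := by
  induction D with
  | nil => exact h'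
  | cons e D ih =>
    exact ⟨⟨fun t ht => mem_derivPool_append.2 (.inl (h.1.1 t ht)), h.1.2⟩, ih h.2⟩

theorem DerivOk.pairClosure {l : List (ℕ × ℕ)} {D : List DerivStep} (h : DerivOk M l D) :
    ∀ t ∈ derivPool l D, PairClosure M l t := by
  induction D with
  | nil => exact fun t ht => .base (by simpa [derivPool] using ht)
  | cons e D ih =>
    intro t ht
    have ht' : t = e.2.2 ∨ t ∈ derivPool l D := by
      simp only [derivPool, List.map_cons, List.mem_append, List.mem_cons] at ht ⊢
      tauto
    rcases ht' with rfl | ht'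
    · have := PairClosure.fn (M := M) (l := l) e.1 e.2.1 (by simpa using h.1.2.1.1)
        fun t ht => ih h.2 t (h.1.1 t ht)
      rwa [h.1.2.1.2.2, h.1.2.2.2.2] at this
    · exact ih h.2 t ht'

theorem exists_derivOk_of_forall_mem {l ts : List (ℕ × ℕ)}
    (h : ∀ t ∈ ts, ∃ D, DerivOk M l D ∧ t ∈ derivPool l D) :
    ∃ D, DerivOk M l D ∧ ∀ t ∈ ts, t ∈ derivPool l D := by
  induction ts with
  | nil => exact ⟨[], trivial, by simp⟩
  | cons t ts ih =>
    obtain ⟨D, hD, ht⟩ := h t List.mem_cons_self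
    obtain ⟨D', hD', hts⟩ := ih fun s hs => h s (List.mem_cons_of_mem _ hs)
    refine ⟨D ++ D', hD.append hD', fun s hs => ?_⟩
    rcases List.mem_cons.1 hs with rfl | hs
    · exact mem_derivPool_append.2 (.inl ht)
    · exact mem_derivPool_append.2 (.inr (hts s hs))

theorem PairClosure.exists_derivOk {l : List (ℕ × ℕ)} (h₁ : TupleIn M (l.map Prod.fst))
    (h₂ : TupleIn M (l.map Prod.snd)) {t : ℕ × ℕ} (h : PairClosure M l t) :
    ∃ D, DerivOk M l D ∧ t ∈ derivPool l D := by
  induction h with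
  | base hp => exact ⟨[], trivial, List.mem_append_left _ hp⟩
  | fn f ts hf hts ih =>
    obtain ⟨D, hD, hmem⟩ := exists_derivOk_of_forall_mem ih
    refine ⟨(f, ts, _, _) :: D, ⟨⟨hmem, ⟨by simpa using hf, fun x hx => ?_, rfl⟩,
      ⟨by simpa using hf, fun x hx => ?_, rfl⟩⟩, hD⟩,
      List.mem_append_right _ List.mem_cons_self⟩
    · obtain ⟨t, ht, rfl⟩ := List.mem_map.1 hx
      exact ((hts t ht).inClosure_fst h₁).mem_dom
    · obtain ⟨t, ht, rfl⟩ := List.mem_map.1 hx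
      exact ((hts t ht).inClosure_snd h₂).mem_dom

theorem clSim_iff_derivOk {l : List (ℕ × ℕ)} (h₁ : TupleIn M (l.map Prod.fst))
    (h₂ : TupleIn M (l.map Prod.snd)) :
    ClSim M (l.map Prod.fst) M (l.map Prod.snd) ↔
      ∀ w : List DerivStep × List (ℕ × ℕ) × ℕ × (ℕ × ℕ) × (ℕ × ℕ), DerivOk M l w.1 →
        (w.2.2.2.1 ∈ derivPool l w.1 → w.2.2.2.2 ∈ derivPool l w.1 →
          (w.2.2.2.1.1 = w.2.2.2.2.1 ↔ w.2.2.2.1.2 = w.2.2.2.2.2)) ∧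
        ((∀ t ∈ w.2.1, t ∈ derivPool l w.1) →
          (M.rel w.2.2.1 (w.2.1.map Prod.fst) ↔ M.rel w.2.2.1 (w.2.1.map Prod.snd))) := by
  rw [clSim_iff_pairClosure h₁ h₂]
  constructor
  · rintro ⟨hpq, hrel⟩ ⟨D, ts, r, p, q⟩ hD
    exact ⟨fun hp hq => hpq p q (hD.pairClosure p hp) (hD.pairClosure q hq),
      fun hts => hrel r ts fun t ht => hD.pairClosure t (hts t ht)⟩
  · refine fun h => ⟨fun p q hp hq => ?_, fun r ts hts => ?_⟩
    · obtain ⟨D, hD, hmem⟩ := exists_derivOk_of_forall_mem (M := M) (l := l) (ts := [p, q])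
        (by simpa using ⟨hp.exists_derivOk h₁ h₂, hq.exists_derivOk h₁ h₂⟩)
      exact (h ⟨D, [], 0, p, q⟩ hD).1 (hmem p (by simp)) (hmem q (by simp))
    · obtain ⟨D, hD, hmem⟩ := exists_derivOk_of_forall_mem
        fun t ht => (hts t ht).exists_derivOk h₁ h₂
      exact (h ⟨D, ts, r, 0, 0⟩ hD).2 hmem

section

variable {O : Set ℕ}

theorem primrecRel_mem_list {α : Type*} [Primcodable α] :
    PrimrecRel fun (a : α) (l : List α) => a ∈ l :=
  (PrimrecRel.exists_mem_list (R := fun a b : α => a = b) Primrec.eq).swap.of_eq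
    fun a l => by simp

theorem primrecRel_forall_mem_mem {α : Type*} [Primcodable α] :
    PrimrecRel fun (l l' : List α) => ∀ t ∈ l, t ∈ l' :=
  PrimrecRel.forall_mem_list primrecRel_mem_list

theorem primrec_derivPool : Primrec₂ derivPool :=
  Primrec.list_append.comp Primrec.fst (Primrec.list_map Primrec.snd
    (Primrec.snd.comp (Primrec.snd.comp Primrec.snd)).to₂)

theorem primrec_map_fst : Primrec fun l : List (ℕ × ℕ) => l.map Prod.fst :=
  Primrec.list_map Primrec.id (Primrec.fst.comp Primrec.snd).to₂

theorem primrec_map_snd : Primrec fun l : List (ℕ × ℕ) => l.map Prod.snd :=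
  Primrec.list_map Primrec.id (Primrec.snd.comp Primrec.snd).to₂

theorem StrComputableIn.decIn_tuple (hM : StrComputableIn O M) :
    DecIn O (fun as : List ℕ => TupleIn M as) :=
  hM.1.decIn.forall_mem_list

theorem StrComputableIn.decIn_rel (hM : StrComputableIn O M) :
    DecIn O (fun t : ℕ × List ℕ => M.rel t.1 t.2) := by
  refine (hM.2.1.decIn.comp_primrec (f := fun t : ℕ × List ℕ => Nat.pair t.1 (Encodable.encode t.2))
    (Primrec₂.natPair.comp Primrec.fst (Primrec.encode.comp Primrec.snd))).of_iff fun t => ?_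
  constructor
  · rintro ⟨r, as, _, hr, e⟩
    obtain ⟨h1, h2⟩ := Nat.pair_eq_pair.1 e
    rwa [h1, Encodable.encode_injective h2]
  · exact fun h => ⟨_, _, (M.rel_valid _ _ h).2, h, rfl⟩

theorem StrComputableIn.decIn_fnGraph (hM : StrComputableIn O M) :
    DecIn O (fun t : ℕ × List ℕ × ℕ => FnGraph M t.1 t.2.1 t.2.2) := by
  refine (hM.2.2.decIn.comp_primrec
    (f := fun t : ℕ × List ℕ × ℕ => Nat.pair t.1 (Nat.pair (Encodable.encode t.2.1) t.2.2))
    (Primrec₂.natPair.comp Primrec.fst (Primrec₂.natPair.comp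
      (Primrec.encode.comp (Primrec.fst.comp Primrec.snd))
      (Primrec.snd.comp Primrec.snd)))).of_iff fun t => ?_
  constructor
  · rintro ⟨f, as, b, hf, has, hb, e⟩
    obtain ⟨h1, h2⟩ := Nat.pair_eq_pair.1 e
    obtain ⟨h2, h3⟩ := Nat.pair_eq_pair.1 h2
    rw [h1, Encodable.encode_injective h2, h3]
    exact ⟨hf, has, hb⟩
  · exact fun h => ⟨_, _, _, h.1, h.2.1, h.2.2, rfl⟩

theorem StrComputableIn.decIn_stepOk (hM : StrComputableIn O M) :
    DecIn O (fun t : List (ℕ × ℕ) × DerivStep => StepOk M t.1 t.2) := by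
  have hargs : Primrec fun t : List (ℕ × ℕ) × DerivStep => t.2.2.1 :=
    Primrec.fst.comp (Primrec.snd.comp Primrec.snd)
  have hout : Primrec fun t : List (ℕ × ℕ) × DerivStep => t.2.2.2 :=
    Primrec.snd.comp (Primrec.snd.comp Primrec.snd)
  have hsym : Primrec fun t : List (ℕ × ℕ) × DerivStep => t.2.1 :=
    Primrec.fst.comp Primrec.snd
  exact (DecIn.of_primrecPred (primrecRel_forall_mem_mem.comp hargs Primrec.fst)).and
    ((hM.decIn_fnGraph.comp_primrec (hsym.pair
      ((primrec_map_fst.comp hargs).pair (Primrec.fst.comp hout)))).and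
    (hM.decIn_fnGraph.comp_primrec (hsym.pair
      ((primrec_map_snd.comp hargs).pair (Primrec.snd.comp hout)))))

theorem StrComputableIn.decIn_derivOk (hM : StrComputableIn O M) :
    DecIn O (fun t : List (ℕ × ℕ) × List DerivStep => DerivOk M t.1 t.2) := by
  have hstep : DecIn O (fun t : (List (ℕ × ℕ) × List DerivStep) × ℕ =>
      StepOk M (derivPool t.1.1 (t.1.2.drop (t.2 + 1))) (t.1.2.getD t.2 default)) :=
    hM.decIn_stepOk.comp_primrec ((primrec_derivPool.comp (Primrec.fst.comp Primrec.fst)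
      (Primrec.list_drop.comp (Primrec.succ.comp Primrec.snd)
        (Primrec.snd.comp Primrec.fst))).pair
      ((Primrec.list_getD default).comp (Primrec.snd.comp Primrec.fst) Primrec.snd))
  exact (hstep.forall_lt.comp_primrec
    (f := fun t : List (ℕ × ℕ) × List DerivStep => (t, t.2.length))
    (Primrec.id.pair (Primrec.list_length.comp Primrec.snd))).of_iff
    fun t => (derivOk_iff_forall_lt (l := t.1) (D := t.2)).symm

/-- Two tuples of `M` of which the coordinatewise map generates an isomorphism. -/
def SimIn (M : Str L) (as bs : List ℕ) : Prop :=
  TupleIn M as ∧ TupleIn M bs ∧ ClSim M as M bs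

theorem StrComputableIn.decIn_clSim_map (hM : StrComputableIn O M) :
    DecIn (jump O) (fun l : List (ℕ × ℕ) => SimIn M (l.map Prod.fst) (l.map Prod.snd)) := by
  have hpool : Primrec fun t : List (ℕ × ℕ) ×
      (List DerivStep × List (ℕ × ℕ) × ℕ × (ℕ × ℕ) × (ℕ × ℕ)) => derivPool t.1 t.2.1 :=
    primrec_derivPool.comp Primrec.fst (Primrec.fst.comp Primrec.snd)
  have hts : Primrec fun t : List (ℕ × ℕ) ×
      (List DerivStep × List (ℕ × ℕ) × ℕ × (ℕ × ℕ) × (ℕ × ℕ)) => t.2.2.1 :=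
    Primrec.fst.comp (Primrec.snd.comp Primrec.snd)
  have hr : Primrec fun t : List (ℕ × ℕ) ×
      (List DerivStep × List (ℕ × ℕ) × ℕ × (ℕ × ℕ) × (ℕ × ℕ)) => t.2.2.2.1 :=
    Primrec.fst.comp (Primrec.snd.comp (Primrec.snd.comp Primrec.snd))
  have hp : Primrec fun t : List (ℕ × ℕ) ×
      (List DerivStep × List (ℕ × ℕ) × ℕ × (ℕ × ℕ) × (ℕ × ℕ)) => t.2.2.2.2.1 :=
    Primrec.fst.comp (Primrec.snd.comp (Primrec.snd.comp (Primrec.snd.comp Primrec.snd)))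
  have hq : Primrec fun t : List (ℕ × ℕ) ×
      (List DerivStep × List (ℕ × ℕ) × ℕ × (ℕ × ℕ) × (ℕ × ℕ)) => t.2.2.2.2.2 :=
    Primrec.snd.comp (Primrec.snd.comp (Primrec.snd.comp (Primrec.snd.comp Primrec.snd)))
  have h := DecIn.forall_jump
    ((hM.decIn_derivOk.comp_primrec (Primrec.fst.pair (Primrec.fst.comp Primrec.snd))).imp
    (((DecIn.of_primrecPred (primrecRel_mem_list.comp hp hpool)).imp
      ((DecIn.of_primrecPred (primrecRel_mem_list.comp hq hpool)).imp
      ((DecIn.of_primrecPred (Primrec.eq.comp (Primrec.fst.comp hp) (Primrec.fst.comp hq))).iff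
        (DecIn.of_primrecPred
          (Primrec.eq.comp (Primrec.snd.comp hp) (Primrec.snd.comp hq)))))).and
    ((DecIn.of_primrecPred (primrecRel_forall_mem_mem.comp hts hpool)).imp
      ((hM.decIn_rel.comp_primrec (hr.pair (primrec_map_fst.comp hts))).iff
        (hM.decIn_rel.comp_primrec (hr.pair (primrec_map_snd.comp hts)))))))
  refine ((hM.decIn_tuple.comp_primrec primrec_map_fst).to_jump.and
    ((hM.decIn_tuple.comp_primrec primrec_map_snd).to_jump.and h)).of_iff fun l => ?_
  exact and_congr_right fun h₁ => and_congr_right fun h₂ => (clSim_iff_derivOk h₁ h₂).symm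

/-- The list of pairs of coordinates of two tuples, padded to the length of the first. -/
def pairUp (as bs : List ℕ) : List (ℕ × ℕ) :=
  (List.range as.length).map fun i => (as.getD i 0, bs.getD i 0)

theorem primrec_pairUp : Primrec₂ pairUp :=
  Primrec.list_map (Primrec.list_range.comp (Primrec.list_length.comp Primrec.fst))
    (((Primrec.list_getD 0).comp (Primrec.fst.comp Primrec.fst) Primrec.snd).pair
      ((Primrec.list_getD 0).comp (Primrec.snd.comp Primrec.fst) Primrec.snd)).to₂

theorem pairUp_fst (as bs : List ℕ) : (pairUp as bs).map Prod.fst = as := by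
  refine List.ext_getElem (by simp [pairUp]) fun i _ h => ?_
  simp [pairUp, h]

theorem pairUp_snd {as bs : List ℕ} (h : as.length = bs.length) :
    (pairUp as bs).map Prod.snd = bs := by
  refine List.ext_getElem (by simp [pairUp, h]) fun i _ h => ?_
  simp [pairUp, h]

theorem SimIn.length_eq {as bs : List ℕ} (h : SimIn M as bs) : as.length = bs.length := by
  obtain ⟨_, _, k, rfl, _⟩ := h
  simp

theorem StrComputableIn.decIn_simIn (hM : StrComputableIn O M) :
    DecIn (jump O) (fun t : List ℕ × List ℕ => SimIn M t.1 t.2) := by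
  have h : DecIn (jump O) fun t : List ℕ × List ℕ => t.1.length = t.2.length :=
    .of_primrecPred (Primrec.eq.comp (Primrec.list_length.comp Primrec.fst)
      (Primrec.list_length.comp Primrec.snd))
  refine (h.and (hM.decIn_clSim_map.comp_primrec primrec_pairUp)).of_iff fun t => ?_
  constructor
  · rintro ⟨hl, h⟩
    rwa [pairUp_fst, pairUp_snd hl] at h
  · intro h
    refine ⟨h.length_eq, ?_⟩
    rwa [pairUp_fst, pairUp_snd h.length_eq]

theorem decIn_tupleSim : DecIn O (fun t : List ℕ × List ℕ => TupleSim t.1 t.2) := by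
  have h1 : PrimrecPred fun t : List ℕ × List ℕ => t.1.length = t.2.length :=
    Primrec.eq.comp (Primrec.list_length.comp Primrec.fst)
      (Primrec.list_length.comp Primrec.snd)
  have h2 : PrimrecRel fun p q : ℕ × ℕ => (p.1 = q.1 ↔ p.2 = q.2) := by
    have ha : PrimrecPred fun t : (ℕ × ℕ) × (ℕ × ℕ) => t.1.1 = t.2.1 :=
      Primrec.eq.comp (Primrec.fst.comp Primrec.fst) (Primrec.fst.comp Primrec.snd)
    have hb : PrimrecPred fun t : (ℕ × ℕ) × (ℕ × ℕ) => t.1.2 = t.2.2 :=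
      Primrec.eq.comp (Primrec.snd.comp Primrec.fst) (Primrec.snd.comp Primrec.snd)
    exact ((ha.and hb).or (ha.not.and hb.not)).of_eq fun t => by tauto
  have h3 : PrimrecPred fun l : List (ℕ × ℕ) => ∀ p ∈ l, ∀ q ∈ l, (p.1 = q.1 ↔ p.2 = q.2) :=
    (PrimrecRel.forall_mem_list (PrimrecRel.forall_mem_list h2).swap).comp Primrec.id Primrec.id
      |>.of_eq fun l => by simp only [id, eq_comm, Function.swap]
  refine (DecIn.of_primrecPred (h1.and (h3.comp primrec_pairUp))).of_iff fun ⟨as, bs⟩ => ?_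
  dsimp only [Function.uncurry]
  constructor
  · rintro ⟨hl, h⟩
    have e1 := pairUp_fst as bs
    have e2 := pairUp_snd hl
    generalize pairUp as bs = l at *
    subst e1 e2
    have hf : ∀ x, x ∈ l.map Prod.fst → ∃ y, (x, y) ∈ l := by simp
    have hg : ∀ y, y ∈ l.map Prod.snd → ∃ x, (x, y) ∈ l := by simp
    choose! f hf using hf
    choose! g hg using hg
    refine ⟨f, g, ?_, ?_⟩
    · rw [List.map_map, List.map_inj_left]
      exact fun p hp => (h _ (hf p.1 (List.mem_map_of_mem hp)) p hp).1 rfl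
    · rw [List.map_map, List.map_inj_left]
      exact fun p hp => (h _ (hg p.2 (List.mem_map_of_mem hp)) p hp).2 rfl
  · rintro ⟨f, g, rfl, hg⟩
    refine ⟨by simp, ?_⟩
    have hz : pairUp as (as.map f) = as.map fun x => (x, f x) := by
      refine List.ext_getElem (by simp [pairUp]) fun i hi _ => ?_
      have hi : i < as.length := by simpa [pairUp] using hi
      simp [pairUp, hi]
    rw [List.map_map] at hg
    have hg' : ∀ x ∈ as, g (f x) = x :=
      List.map_inj_left.1 (hg.trans (List.map_id as).symm)
    simp only [hz, List.mem_map, forall_exists_index, and_imp, forall_apply_eq_imp_iff₂]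
    intro x hx y hy
    exact ⟨fun e => e ▸ rfl, fun e => by rw [← hg' x hx, ← hg' y hy, e]⟩

end

/-! ### Embeddings, automorphisms and the cofinal collection -/

/-- `A` carries the structure induced from `M` on a subset closed under the functions. -/
structure IsInduced (A M : Str L) : Prop where
  fn_eq : A.fn = M.fn
  mem : ∀ x ∈ A.dom, x ∈ M.dom
  rel_iff : ∀ r as, TupleIn A as → (A.rel r as ↔ M.rel r as)

theorem IsInduced.refl (M : Str L) : IsInduced M M :=
  ⟨rfl, fun _ h => h, fun _ _ _ => Iff.rfl⟩

theorem IsInduced.sub (M : Str L) (as : List ℕ) : IsInduced (M.sub as) M :=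
  ⟨rfl, fun _ h => InClosure.mem_dom h, fun _ _ h => and_iff_left h⟩

theorem IsEmbMap.to_super {A B M : Str L} {h : ℕ → ℕ} (hB : IsInduced B M)
    (hh : IsEmbMap A B h) : IsEmbMap A M h := by
  obtain ⟨hd, hi, hr, hf⟩ := hh
  refine ⟨fun x hx => hB.mem _ (hd x hx), hi, fun r as has => (hr r as has).trans
    (hB.rel_iff r _ fun y hy => ?_), fun f as ha has => ?_⟩
  · obtain ⟨x, hx, rfl⟩ := List.mem_map.1 hy
    exact hd x (has x hx)
  · rw [hf f as ha has, hB.fn_eq]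

theorem IsEmbMap.comp {A B C : Str L} {h k : ℕ → ℕ} (hk : IsEmbMap B C k)
    (hh : IsEmbMap A B h) : IsEmbMap A C (k ∘ h) := by
  have hmap : ∀ as, TupleIn A as → TupleIn B (as.map h) := fun as has y hy => by
    obtain ⟨x, hx, rfl⟩ := List.mem_map.1 hy
    exact hh.1 x (has x hx)
  refine ⟨fun x hx => hk.1 _ (hh.1 x hx), fun x hx y hy e => hh.2.1 x hx y hy
    (hk.2.1 _ (hh.1 x hx) _ (hh.1 y hy) e), fun r as has => ?_, fun f as ha has => ?_⟩
  · rw [hh.2.2.1 r as has, hk.2.2.1 r _ (hmap as has), List.map_map]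
  · rw [Function.comp_apply, hh.2.2.2 f as ha has,
      hk.2.2.2 f _ (by simpa using ha) (hmap as has), List.map_map]

theorem IsEmbMap.tupleIn_map {A B : Str L} {h : ℕ → ℕ} (hh : IsEmbMap A B h) {as : List ℕ}
    (has : TupleIn A as) : TupleIn B (as.map h) := fun y hy => by
  obtain ⟨x, hx, rfl⟩ := List.mem_map.1 hy
  exact hh.1 x (has x hx)

theorem InClosure.mem_of_isInduced {A : Str L} (hA : IsInduced A M) {as : List ℕ}
    (has : TupleIn A as) {x : ℕ} (hx : InClosure M as x) : x ∈ A.dom := by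
  induction hx with
  | base hx _ => exact has _ hx
  | fn f ts hf _ ih => exact hA.fn_eq ▸ A.fn_mem f ts hf ih

/-- An embedding of an induced structure generates isomorphisms of generated substructures. -/
theorem IsEmbMap.clSim_map {A : Str L} {h : ℕ → ℕ} (hA : IsInduced A M) (hh : IsEmbMap A M h)
    {as : List ℕ} (has : TupleIn A as) : ClSim M as M (as.map h) := by
  have hmem : ∀ x, InClosure M as x → x ∈ A.dom := fun x hx => hx.mem_of_isInduced hA has
  have hfn : ∀ f ts, L.funArity f = some ts.length → (∀ x ∈ ts, InClosure M as x) →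
      h (M.fn f ts) = M.fn f (ts.map h) := fun f ts hf hts => by
    rw [← hh.2.2.2 f ts hf fun x hx => hmem x (hts x hx), hA.fn_eq]
  have hcl : ∀ x, InClosure M as x → InClosure M (as.map h) (h x) := by
    intro x hx
    induction hx with
    | base hx _ => exact .base (List.mem_map_of_mem hx) (hh.1 _ (has _ hx))
    | fn f ts hf hts ih =>
      rw [hfn f ts hf hts]
      exact .fn f _ (by simpa using hf) (by simpa using ih)
  refine ⟨h, rfl, ⟨hcl, fun x hx y hy e => hh.2.1 x (hmem x hx) y (hmem y hy) e,
    fun r ts hts => ?_, hfn⟩, fun y hy => ?_⟩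
  · have hts' : TupleIn A ts := fun x hx => hmem x (hts x hx)
    refine and_congr ((hA.rel_iff r ts hts').symm.trans (hh.2.2.1 r ts hts'))
      (iff_of_true hts fun y hy => ?_)
    obtain ⟨x, hx, rfl⟩ := List.mem_map.1 hy
    exact hcl x (hts x hx)
  · simp only [Str.sub, Set.mem_ofPred_eq] at hy ⊢
    induction hy with
    | base hy _ =>
      obtain ⟨x, hx, rfl⟩ := List.mem_map.1 hy
      exact ⟨x, .base hx (hA.mem _ (has x hx)), rfl⟩
    | fn f ts hf _ ih =>
      choose! k hk using ih
      have hks : ∀ x ∈ ts.map k, InClosure M as x := by simpa using fun x hx => (hk x hx).1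
      refine ⟨M.fn f (ts.map k), .fn f _ (by simpa using hf) hks, ?_⟩
      rw [hfn f _ (by simpa using hf) hks, List.map_map,
        List.map_congr_left (f := h ∘ k) (g := id) fun x hx => (hk x hx).2, List.map_id]

theorem IsAutoOf.simIn_map {g : ℕ → ℕ} (hg : IsAutoOf M g) {as : List ℕ} (has : TupleIn M as) :
    SimIn M as (as.map g) :=
  ⟨has, hg.1.tupleIn_map has, hg.1.clSim_map (.refl M) has⟩

theorem IsAutoOf.comp {g k : ℕ → ℕ} (hk : IsAutoOf M k) (hg : IsAutoOf M g) :
    IsAutoOf M (k ∘ g) := by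
  refine ⟨hk.1.comp hg.1, fun z hz => ?_⟩
  obtain ⟨y, hy, rfl⟩ := hk.2 z hz
  obtain ⟨x, hx, rfl⟩ := hg.2 y hy
  exact ⟨x, hx, rfl⟩

theorem IsAutoOf.exists_inverse {g : ℕ → ℕ} (hg : IsAutoOf M g) :
    ∃ k, IsAutoOf M k ∧ ∀ x ∈ M.dom, k (g x) = x := by
  choose! k hk using hg.2
  have hkg : ∀ x ∈ M.dom, k (g x) = x := fun x hx =>
    hg.1.2.1 _ (hk _ (hg.1.1 x hx)).1 x hx (hk _ (hg.1.1 x hx)).2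
  have hgk : ∀ as, TupleIn M as → (as.map k).map g = as := fun as has => by
    rw [List.map_map,
      List.map_congr_left (f := g ∘ k) (g := id) fun x hx => (hk x (has x hx)).2, List.map_id]
  have hks : ∀ as, TupleIn M as → TupleIn M (as.map k) := fun as has y hy => by
    obtain ⟨x, hx, rfl⟩ := List.mem_map.1 hy
    exact (hk x (has x hx)).1
  refine ⟨k, ⟨⟨fun x hx => (hk x hx).1, fun x hx y hy e => ?_, fun r as has => ?_,
    fun f as hf has => ?_⟩, fun y hy => ⟨g y, hg.1.1 y hy, hkg y hy⟩⟩, hkg⟩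
  · rw [← (hk x hx).2, ← (hk y hy).2, e]
  · rw [hg.1.2.2.1 r _ (hks as has), hgk as has]
  · have hf' : L.funArity f = some (as.map k).length := by simpa using hf
    conv_lhs => rw [← hgk as has]
    rw [← hg.1.2.2.2 f _ hf' (hks as has), hkg _ (M.fn_mem f _ hf' (hks as has))]

theorem ClSim.trans {as bs cs : List ℕ} (has : TupleIn M as) (hbs : TupleIn M bs)
    (h : ClSim M as M bs) (h' : ClSim M bs M cs) : ClSim M as M cs := by
  obtain ⟨h, rfl, hh, _⟩ := h
  obtain ⟨k, rfl, hk, _⟩ := h'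
  rw [List.map_map]
  exact ((hk.comp hh).to_super (.sub M _)).clSim_map (.sub M as)
    fun x hx => .base hx (has x hx)

/-- Two embeddings agreeing on generators agree on the generated substructure. -/
theorem IsEmbMap.eq_of_map_eq {A : Str L} {g h : ℕ → ℕ} (hA : IsInduced A M)
    (hg : IsEmbMap M M g) (hh : IsEmbMap A M h) {bs : List ℕ} (hbs : TupleIn A bs)
    (e : bs.map g = bs.map h) {x : ℕ} (hx : InClosure M bs x) : g x = h x := by
  induction hx with
  | base hx _ => exact List.map_inj_left.1 e _ hx
  | fn f ts hf hts ih =>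
    have hts' : TupleIn A ts := fun x hx => (hts x hx).mem_of_isInduced hA hbs
    rw [hg.2.2.2 f ts hf fun x hx => (hts x hx).mem_dom, List.map_congr_left ih,
      ← hh.2.2.2 f ts hf hts', hA.fn_eq]

/-- The tuples of `M` all of whose isomorphic copies in `M` are conjugate to them under
automorphisms. -/
def homogTuples (M : Str L) : Set (List ℕ) :=
  { as | TupleIn M as ∧ ∀ cs, SimIn M as cs → ∃ g, IsAutoOf M g ∧ as.map g = cs }

theorem isCofinalCollection_homogTuples (hcu : CofinallyUltrahomogeneous M) :
    IsCofinalCollection M (homogTuples M) := by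
  refine ⟨fun _ h => h.1, fun as has => ?_, fun bs hbs as has => ⟨fun x hx => ?_, ?_⟩,
    fun as has bs hbs hab => ⟨hbs, ?_⟩⟩
  · obtain ⟨bs, hbs, hcl, h⟩ := hcu as has
    exact ⟨bs, ⟨hbs, fun cs hcs => h cs hcs.2.1 hcs.2.2⟩, hcl⟩
  · rcases List.mem_append.1 hx with hx | hx
    · exact (has x hx).mem_dom
    · exact hbs.1 x hx
  · rintro cs ⟨hab, hcs, h, rfl, hh, _⟩
    have hh : IsEmbMap (M.sub (as ++ bs)) M h := hh.to_super (.sub M _)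
    have hbs' : TupleIn (M.sub (as ++ bs)) bs := fun x hx =>
      .base (List.mem_append_right _ hx) (hbs.1 x hx)
    obtain ⟨g, hg, e⟩ := hbs.2 (bs.map h)
      ⟨hbs.1, hh.tupleIn_map hbs', hh.clSim_map (.sub M _) hbs'⟩
    refine ⟨g, hg, List.map_congr_left fun x hx => ?_⟩
    refine hg.1.eq_of_map_eq (.sub M _) hh hbs' e ?_
    rcases List.mem_append.1 hx with hx | hx
    · exact has x hx
    · exact .base hx (hbs.1 x hx)
  · rintro cs ⟨_, hcs, hbc⟩
    obtain ⟨g, hg, rfl⟩ := has.2 bs ⟨has.1, hbs, hab⟩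
    obtain ⟨k, hk, rfl⟩ := has.2 cs ⟨has.1, hcs, hab.trans has.1 hbs hbc⟩
    obtain ⟨i, hi, hig⟩ := hg.exists_inverse
    refine ⟨k ∘ i, hk.comp hi, ?_⟩
    rw [List.map_map]
    exact List.map_congr_left fun x hx => congrArg k (hig x (has.1 x hx))

theorem mem_homogTuples_iff (hcu : CofinallyUltrahomogeneous M) (as : List ℕ) :
    as ∈ homogTuples M ↔ TupleIn M as ∧ ∀ t : List ℕ × List ℕ, SimIn M as t.1 → TupleIn M t.2 →
      ∃ v, SimIn M (as ++ t.2) (t.1 ++ v) := by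
  obtain ⟨_, hcof, happ, _⟩ := isCofinalCollection_homogTuples hcu
  refine and_congr_right fun has => ⟨fun h ⟨cs, u⟩ hcs hu => ?_, fun h cs hcs => ?_⟩
  · obtain ⟨g, hg, rfl⟩ := h cs hcs
    refine ⟨u.map g, ?_⟩
    rw [← List.map_append]
    exact hg.simIn_map fun x hx => (List.mem_append.1 hx).elim (has x) (hu x)
  · obtain ⟨u, hu, hcl⟩ := hcof as has
    obtain ⟨v, hv⟩ := h (cs, u) hcs hu.1
    obtain ⟨g, hg, e⟩ := (happ u hu as hcl).2 _ hv
    rw [List.map_append] at e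
    exact ⟨g, hg, List.append_inj_left e (by simpa using hcs.length_eq)⟩

theorem StrComputableIn.decIn_homogTuples {O : Set ℕ} (hM : StrComputableIn O M)
    (hcu : CofinallyUltrahomogeneous M) :
    DecIn (jump (jump (jump O))) (fun as => as ∈ homogTuples M) := by
  have hex : DecIn (jump (jump O)) fun t : List ℕ × List ℕ × List ℕ =>
      ∃ v, SimIn M (t.1 ++ t.2.2) (t.2.1 ++ v) :=
    DecIn.exists_jump (p := fun t : (List ℕ × List ℕ × List ℕ) × List ℕ =>
        SimIn M (t.1.1 ++ t.1.2.2) (t.1.2.1 ++ t.2))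
      (hM.decIn_simIn.comp_primrec ((Primrec.list_append.comp (Primrec.fst.comp Primrec.fst)
        (Primrec.snd.comp (Primrec.snd.comp Primrec.fst))).pair
        (Primrec.list_append.comp (Primrec.fst.comp (Primrec.snd.comp Primrec.fst)) Primrec.snd)))
  have hsim : DecIn (jump (jump O)) fun t : List ℕ × List ℕ × List ℕ => SimIn M t.1 t.2.1 :=
    (hM.decIn_simIn.comp_primrec
      (Primrec.fst.pair (Primrec.fst.comp Primrec.snd))).to_jump
  have htup : DecIn (jump (jump O)) fun t : List ℕ × List ℕ × List ℕ => TupleIn M t.2.2 :=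
    (hM.decIn_tuple.comp_primrec (Primrec.snd.comp Primrec.snd)).to_jump.to_jump
  exact (hM.decIn_tuple.to_jump.to_jump.to_jump.and
    (hsim.imp (htup.imp hex)).forall_jump).of_iff fun as => (mem_homogTuples_iff hcu as).symm

theorem exists_mem_homogTuples_extension (hcu : CofinallyUltrahomogeneous M) {p q : List ℕ}
    (hp : p ∈ homogTuples M) (hpq : SimIn M p q) {n : ℕ} (hn : n ∈ M.dom) :
    ∃ c d, p ++ c ∈ homogTuples M ∧ SimIn M (p ++ c) (q ++ d) ∧ n ∈ c ∧ n ∈ d := by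
  obtain ⟨_, hcof, happ, _⟩ := isCofinalCollection_homogTuples hcu
  obtain ⟨g, hg, rfl⟩ := hp.2 q hpq
  obtain ⟨m, hm, e⟩ := hg.2 n hn
  have hpc : TupleIn M (p ++ [n, m]) := fun x hx => by
    simp only [List.mem_append, List.mem_cons, List.not_mem_nil, or_false] at hx
    rcases hx with hx | rfl | rfl
    exacts [hp.1 x hx, hn, hm]
  obtain ⟨bs, hbs, hcl⟩ := hcof _ hpc
  have hE : p ++ ([n, m] ++ bs) ∈ homogTuples M := by
    rw [← List.append_assoc]
    exact happ bs hbs _ hcl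
  refine ⟨[n, m] ++ bs, ([n, m] ++ bs).map g, hE, ?_, by simp, by simp [e]⟩
  rw [← List.map_append]
  exact hg.simIn_map hE.1

/-! ### Back and forth -/

theorem TupleSim.length_eq {p q : List ℕ} (h : TupleSim p q) : p.length = q.length := by
  obtain ⟨k, _, rfl, _⟩ := h
  simp

/-- Two tuples with the same equality pattern are conjugate under a permutation of the domain. -/
theorem TupleSim.exists_perm {p q : List ℕ} (h : TupleSim p q) (hp : TupleIn M p)
    (hq : TupleIn M q) :
    ∃ σ : Equiv.Perm ℕ, (∀ x, σ x ∈ M.dom ↔ x ∈ M.dom) ∧ p.map σ = q := by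
  obtain ⟨f, f', rfl, hf'⟩ := h
  induction p with
  | nil => exact ⟨1, by simp, rfl⟩
  | cons a p ih =>
    simp only [List.map_cons, List.cons.injEq, TupleIn, List.mem_cons, forall_eq_or_imp]
      at hf' hp hq
    obtain ⟨σ, hσ, e⟩ := ih hp.2 hq.2 hf'.2
    have hd := (hσ a).2 hp.1
    refine ⟨Equiv.swap (σ a) (f a) * σ, fun x => ?_, ?_⟩
    · rw [Equiv.Perm.mul_apply, ← hσ x]
      rw [Equiv.swap_apply_def]
      split_ifs with h₁ h₂
      · rw [h₁]
        exact iff_of_true hq.1 hd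
      · rw [h₂]
        exact iff_of_true hd hq.1
      · rfl
    · rw [List.map_cons, List.map_cons, Equiv.Perm.mul_apply, Equiv.swap_apply_left]
      congr 1
      refine List.map_congr_left fun x hx => ?_
      have hx' : σ x = f x := List.map_inj_left.1 e x hx
      rw [Equiv.Perm.mul_apply]
      by_cases hxa : x = a
      · rw [hxa, Equiv.swap_apply_left]
      · refine (Equiv.swap_apply_of_ne_of_ne (fun h => hxa (σ.injective h)) fun h => hxa ?_).trans
          hx'
        rw [List.map_map] at hf'
        have h2 := List.map_inj_left.1 (hf'.2.trans (List.map_id p).symm) x hx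
        rw [Function.comp_apply, ← hx', h, hf'.1] at h2
        exact h2.symm

theorem TupleSim.exists_extension {p q : List ℕ} (h : TupleSim p q) (hp : TupleIn M p)
    (hq : TupleIn M q) {n : ℕ} (hn : n ∈ M.dom) :
    ∃ c d, TupleIn M (p ++ c) ∧ TupleIn M (q ++ d) ∧ TupleSim (p ++ c) (q ++ d) ∧
      n ∈ c ∧ n ∈ d := by
  obtain ⟨σ, hσ, rfl⟩ := h.exists_perm hp hq
  have hm : σ.symm n ∈ M.dom := by rwa [← hσ, Equiv.apply_symm_apply]
  have hpc : TupleIn M (p ++ [n, σ.symm n]) := fun x hx => by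
    simp only [List.mem_append, List.mem_cons, List.not_mem_nil, or_false] at hx
    rcases hx with hx | rfl | rfl
    exacts [hp x hx, hn, hm]
  refine ⟨[n, σ.symm n], [n, σ.symm n].map σ, hpc, ?_, ?_, by simp, by simp⟩
  · rw [← List.map_append]
    intro y hy
    obtain ⟨x, hx, rfl⟩ := List.mem_map.1 hy
    exact (hσ x).2 (hpc x hx)
  · rw [← List.map_append]
    exact ⟨σ, σ.symm, rfl, by rw [List.map_map, Equiv.symm_comp_self, List.map_id]⟩

/-- The map read off an increasing chain of pairs of tuples whose two sides exhaust the domain. -/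
theorem bijOnDom_of_chain {S : ℕ → List ℕ × List ℕ}
    (hmono : ∀ n, (S n).1 <+: (S (n + 1)).1 ∧ (S n).2 <+: (S (n + 1)).2)
    (hin : ∀ n, TupleIn M (S n).1 ∧ TupleIn M (S n).2 ∧ TupleSim (S n).1 (S n).2)
    (hmem : ∀ n ∈ M.dom, n ∈ (S (n + 1)).1 ∧ n ∈ (S (n + 1)).2) {g : ℕ → ℕ}
    (hg : ∀ x, g x = (S (x + 1)).2.getD ((S (x + 1)).1.idxOf x) 0) :
    BijOnDom M g ∧ (∀ n, (S n).1.map g = (S n).2) ∧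
      ∀ as, TupleIn M as → ∃ n, ∀ x ∈ as, x ∈ (S n).1 := by
  have hle : ∀ {m n}, m ≤ n → (S m).1 <+: (S n).1 ∧ (S m).2 <+: (S n).2 := by
    intro m n h
    induction h with
    | refl => exact ⟨List.prefix_rfl, List.prefix_rfl⟩
    | step _ ih => exact ⟨ih.1.trans (hmono _).1, ih.2.trans (hmono _).2⟩
  have hres : ∀ {m n} {k : ℕ → ℕ}, m ≤ n → (S n).1.map k = (S n).2 → (S m).1.map k = (S m).2 := by
    intro m n k h e
    obtain ⟨⟨u, hu⟩, ⟨v, hv⟩⟩ := hle h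
    rw [← hu, ← hv, List.map_append] at e
    exact List.append_inj_left e (by simpa using (hin m).2.2.length_eq)
  have hval : ∀ x ∈ M.dom, ∀ k : ℕ → ℕ, (S (x + 1)).1.map k = (S (x + 1)).2 → g x = k x := by
    intro x hx k hk
    have hlt := List.idxOf_lt_length_of_mem (hmem x hx).1
    rw [hg, ← hk, List.getD_eq_getElem _ _ (by simpa using hlt), List.getElem_map,
      List.getElem_idxOf]
  have hmap : ∀ n, (S n).1.map g = (S n).2 := by
    intro n
    obtain ⟨k, _, hk, _⟩ := (hin n).2.2
    rw [← hk]
    refine List.map_congr_left fun x hx => ?_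
    obtain ⟨k', _, hk', _⟩ := (hin (max n (x + 1))).2.2
    rw [hval x ((hin n).1 x hx) k' (hres (le_max_right _ _) hk')]
    exact List.map_inj_left.1 ((hres (le_max_left _ _) hk').trans hk.symm) x hx
  have hcov : ∀ as, TupleIn M as → ∃ n, ∀ x ∈ as, x ∈ (S n).1 := by
    intro as has
    induction as with
    | nil => exact ⟨0, by simp⟩
    | cons a as ih =>
      obtain ⟨n, hn⟩ := ih fun x hx => has x (List.mem_cons_of_mem _ hx)
      refine ⟨max n (a + 1), fun x hx => ?_⟩
      rcases List.mem_cons.1 hx with rfl | hx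
      · exact (hle (le_max_right _ _)).1.subset (hmem x (has x List.mem_cons_self)).1
      · exact (hle (le_max_left _ _)).1.subset (hn x hx)
  refine ⟨⟨fun x hx => ?_, fun x hx y hy e => ?_, fun y hy => ?_⟩, hmap, hcov⟩
  · refine (hin (x + 1)).2.1 _ ?_
    rw [← hmap]
    exact List.mem_map_of_mem (hmem x hx).1
  · obtain ⟨n, hn⟩ := hcov [x, y] (by simp [TupleIn, hx, hy])
    obtain ⟨_, k', _, hk'⟩ := (hin n).2.2
    rw [← hmap, List.map_map] at hk'
    have := List.map_inj_left.1 (hk'.trans (List.map_id _).symm)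
    have h1 := this x (hn x (by simp))
    have h2 := this y (hn y (by simp))
    rw [Function.comp_apply, e] at h1
    exact h1.symm.trans h2
  · have := (hmem y hy).2
    rw [← hmap] at this
    obtain ⟨x, hx, e⟩ := List.mem_map.1 this
    exact ⟨x, (hin _).1 x hx, e⟩

theorem isAutoOf_of_bijOnDom {g : ℕ → ℕ} (hbij : BijOnDom M g)
    (h : ∀ as, TupleIn M as → ∃ p, (∀ x ∈ as, x ∈ p) ∧ SimIn M p (p.map g)) :
    IsAutoOf M g := by
  have key : ∀ as, TupleIn M as → ∃ k, (∀ x ∈ as, k x = g x) ∧ ∃ p, (∀ x ∈ as, x ∈ (M.sub p).dom) ∧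
      IsEmbMap (M.sub p) M k := by
    intro as has
    obtain ⟨p, hp, hpM, _, k, hk, hiso⟩ := h as has
    exact ⟨k, fun x hx => List.map_inj_left.1 hk x (hp x hx), p,
      fun x hx => .base (hp x hx) (has x hx), hiso.1.to_super (.sub M _)⟩
  refine ⟨⟨hbij.1, hbij.2.1, fun r as has => ?_, fun f as hf has => ?_⟩, hbij.2.2⟩
  · obtain ⟨k, hk, p, hp, hemb⟩ := key as has
    rw [← List.map_congr_left hk, ← hemb.2.2.1 r as hp, (IsInduced.sub M p).rel_iff r as hp]
  · obtain ⟨k, hk, p, hp, hemb⟩ := key (M.fn f as :: as) fun x hx => by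
      rcases List.mem_cons.1 hx with rfl | hx
      exacts [M.fn_mem f as hf has, has x hx]
    rw [← hk _ List.mem_cons_self,
      ← List.map_congr_left fun x hx => hk x (List.mem_cons_of_mem _ hx)]
    exact hemb.2.2.2 f as hf fun x hx => hp x (List.mem_cons_of_mem _ hx)

/-- A decidable back-and-forth system, with a parameter giving the initial pair of tuples, yields a
uniformly computable family of bijections of the domain. -/
theorem exists_compIn_backAndForth {O : Set ℕ}
    {R : (List ℕ × List ℕ) × (List ℕ × List ℕ) → Prop} (hR : DecIn O R)
    (hdom : DecIn O (fun n => n ∈ M.dom))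
    (hin : ∀ k s, R (k, s) → TupleIn M s.1 ∧ TupleIn M s.2 ∧ TupleSim s.1 s.2)
    (hext : ∀ k s, R (k, s) → ∀ n ∈ M.dom,
      ∃ c d, R (k, (s.1 ++ c, s.2 ++ d)) ∧ n ∈ c ∧ n ∈ d) :
    ∃ F : (List ℕ × List ℕ) × ℕ → ℕ, CompIn O F ∧ ∀ k, R (k, k) → ∀ g, (∀ x, g x = F (k, x)) →
      BijOnDom M g ∧ k.1.map g = k.2 ∧
      ∀ as, TupleIn M as → ∃ p, (∀ x ∈ as, x ∈ p) ∧ R (k, (p, p.map g)) := by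
  have hsearch : DecIn O fun t : ((List ℕ × List ℕ) × ℕ × (List ℕ × List ℕ)) × (List ℕ × List ℕ) =>
      R (t.1.1, t.1.2.2) → R (t.1.1, (t.1.2.2.1 ++ t.2.1, t.1.2.2.2 ++ t.2.2)) ∧
        (t.1.2.1 ∈ M.dom → t.1.2.1 ∈ t.2.1 ∧ t.1.2.1 ∈ t.2.2) := by
    have hk : Primrec fun t : ((List ℕ × List ℕ) × ℕ × (List ℕ × List ℕ)) × (List ℕ × List ℕ) =>
        t.1.1 := Primrec.fst.comp Primrec.fst
    have hn : Primrec fun t : ((List ℕ × List ℕ) × ℕ × (List ℕ × List ℕ)) × (List ℕ × List ℕ) =>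
        t.1.2.1 := Primrec.fst.comp (Primrec.snd.comp Primrec.fst)
    have hs : Primrec fun t : ((List ℕ × List ℕ) × ℕ × (List ℕ × List ℕ)) × (List ℕ × List ℕ) =>
        t.1.2.2 := Primrec.snd.comp (Primrec.snd.comp Primrec.fst)
    have hc : Primrec fun t : ((List ℕ × List ℕ) × ℕ × (List ℕ × List ℕ)) × (List ℕ × List ℕ) =>
        t.2.1 := Primrec.fst.comp Primrec.snd
    have hd : Primrec fun t : ((List ℕ × List ℕ) × ℕ × (List ℕ × List ℕ)) × (List ℕ × List ℕ) =>
        t.2.2 := Primrec.snd.comp Primrec.snd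
    exact (hR.comp_primrec (hk.pair hs)).imp ((hR.comp_primrec (hk.pair
      ((Primrec.list_append.comp (Primrec.fst.comp hs) hc).pair
        (Primrec.list_append.comp (Primrec.snd.comp hs) hd)))).and
      ((hdom.comp_primrec hn).imp ((DecIn.of_primrecPred (primrecRel_mem_list.comp hn hc)).and
        (DecIn.of_primrecPred (primrecRel_mem_list.comp hn hd)))))
  obtain ⟨w, hw, hwspec⟩ := hsearch.exists_choice fun ⟨k, n, s⟩ => by
    by_cases hs : R (k, s)
    · by_cases hn : n ∈ M.dom
      · obtain ⟨c, d, h, hc, hd⟩ := hext k s hs n hn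
        exact ⟨(c, d), fun _ => ⟨h, fun _ => ⟨hc, hd⟩⟩⟩
      · exact ⟨([], []), fun _ => ⟨by simpa using hs, fun h => absurd h hn⟩⟩
    · exact ⟨([], []), fun h => absurd h hs⟩
  have hstep : CompIn O fun t : (List ℕ × List ℕ) × ℕ × (List ℕ × List ℕ) =>
      (t.2.2.1 ++ (w t).1, t.2.2.2 ++ (w t).2) :=
    CompIn.comp (f := fun u : (List ℕ × List ℕ) × (List ℕ × List ℕ) =>
        (u.1.1 ++ u.2.1, u.1.2 ++ u.2.2))
      (.of_primrec ((Primrec.list_append.comp (Primrec.fst.comp Primrec.fst)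
        (Primrec.fst.comp Primrec.snd)).pair (Primrec.list_append.comp
          (Primrec.snd.comp Primrec.fst) (Primrec.snd.comp Primrec.snd))))
      (CompIn.pair (.of_primrec (Primrec.snd.comp Primrec.snd)) hw)
  let S : List ℕ × List ℕ → ℕ → List ℕ × List ℕ := fun k n =>
    Nat.rec k (fun y s => (s.1 ++ (w (k, y, s)).1, s.2 ++ (w (k, y, s)).2)) n
  have hS : CompIn O fun t : (List ℕ × List ℕ) × ℕ => S t.1 (t.2 + 1) :=
    (CompIn.nat_rec (.of_primrec Primrec.id) hstep).comp
      (.of_primrec (Primrec.fst.pair (Primrec.succ.comp Primrec.snd)))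
  refine ⟨fun t => (S t.1 (t.2 + 1)).2.getD ((S t.1 (t.2 + 1)).1.idxOf t.2) 0,
    CompIn.comp (f := fun u : (List ℕ × List ℕ) × ℕ => u.1.2.getD (u.1.1.idxOf u.2) 0)
      (.of_primrec ((Primrec.list_getD 0).comp (Primrec.snd.comp Primrec.fst)
        (Primrec.list_idxOf.comp Primrec.snd (Primrec.fst.comp Primrec.fst))))
      (hS.pair (.of_primrec Primrec.snd)), fun k hk g hg => ?_⟩
  have hRS : ∀ n, R (k, S k n) := by
    intro n
    induction n with
    | zero => exact hk
    | succ n ih => exact (hwspec (k, n, S k n) ih).1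
  obtain ⟨hbij, hmap, hcov⟩ := bijOnDom_of_chain (M := M) (S := S k) (g := g)
    (fun n => ⟨List.prefix_append _ _, List.prefix_append _ _⟩) (fun n => hin k _ (hRS n))
    (fun n hn => by
      have := (hwspec (k, n, S k n) (hRS n)).2 hn
      exact ⟨List.mem_append_right _ this.1, List.mem_append_right _ this.2⟩) hg
  refine ⟨hbij, hmap 0, fun as has => ?_⟩
  obtain ⟨n, hn⟩ := hcov as has
  refine ⟨(S k n).1, hn, ?_⟩
  rw [hmap]
  exact hRS n

theorem SimIn.tupleSim {as bs : List ℕ} (h : SimIn M as bs) : TupleSim as bs := by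
  obtain ⟨has, _, k, rfl, hk, _⟩ := h
  have hcl : ∀ x ∈ as, InClosure M as x := fun x hx => .base hx (has x hx)
  have hex : ∀ y ∈ as.map k, ∃ x ∈ as, k x = y := fun y hy => List.mem_map.1 hy
  choose! k' hk' using hex
  refine ⟨k, k', rfl, ?_⟩
  rw [List.map_map]
  conv_rhs => rw [← List.map_id as]
  refine List.map_congr_left fun x hx => ?_
  have := hk' (k x) (List.mem_map_of_mem hx)
  exact hk.2.1 _ (hcl _ this.1) _ (hcl x hx) this.2

end Support

/-- A computable cofinally ultrahomogeneous structure is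
`0'''`-computably cofinally ultrahomogeneous. -/
theorem cofultra_implies_triple_jump_comp_cofultra {L : Lang} (hL : L.ComputableRep)
    (M : Str L) (hM : StrComputableIn ∅ M)
    (hcu : CofinallyUltrahomogeneous M) :
    CompCofUltrahom zeroJump3 M := by
  have hE : DecIn zeroJump3 fun as => as ∈ homogTuples M := hM.decIn_homogTuples hcu
  have hsim : DecIn zeroJump3 fun t : List ℕ × List ℕ => SimIn M t.1 t.2 :=
    hM.decIn_simIn.to_jump.to_jump
  have htup : DecIn zeroJump3 fun as => TupleIn M as := hM.decIn_tuple.to_jump.to_jump.to_jump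
  have hdom : DecIn zeroJump3 fun n => n ∈ M.dom := hM.1.decIn.to_jump.to_jump.to_jump
  refine ⟨homogTuples M, isCofinalCollection_homogTuples hcu, DecIn.setRecIn ?_, ?_⟩
  · refine (hE.comp_primrec (primrec_decode_getD (β := List ℕ))).of_iff fun n => ?_
    constructor
    · intro h
      refine ⟨_, h, ?_⟩
      simp
    · rintro ⟨as, has, rfl⟩
      simpa using has
  · let R : (List ℕ × List ℕ) × (List ℕ × List ℕ) → Prop := fun t =>
      (SimIn M t.1.1 t.1.2 → t.2.1 ∈ homogTuples M ∧ SimIn M t.2.1 t.2.2) ∧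
      (¬ SimIn M t.1.1 t.1.2 → TupleIn M t.2.1 ∧ TupleIn M t.2.2 ∧ TupleSim t.2.1 t.2.2)
    have hs1 : Primrec fun t : (List ℕ × List ℕ) × (List ℕ × List ℕ) => t.2.1 :=
      Primrec.fst.comp Primrec.snd
    have hs2 : Primrec fun t : (List ℕ × List ℕ) × (List ℕ × List ℕ) => t.2.2 :=
      Primrec.snd.comp Primrec.snd
    have hR : DecIn zeroJump3 R :=
      ((hsim.comp_primrec Primrec.fst).imp
        ((hE.comp_primrec hs1).and (hsim.comp_primrec Primrec.snd))).and
      ((hsim.comp_primrec Primrec.fst).not.imp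
        ((htup.comp_primrec hs1).and ((htup.comp_primrec hs2).and
          (decIn_tupleSim.comp_primrec Primrec.snd))))
    obtain ⟨F, hF, hFspec⟩ := exists_compIn_backAndForth (M := M) hR hdom
      (fun k s h => by
        by_cases hk : SimIn M k.1 k.2
        · have := (h.1 hk).2
          exact ⟨this.1, this.2.1, this.tupleSim⟩
        · exact h.2 hk)
      (fun k s h n hn => by
        by_cases hk : SimIn M k.1 k.2
        · obtain ⟨c, d, h1, h2, h3⟩ :=
            exists_mem_homogTuples_extension hcu (h.1 hk).1 (h.1 hk).2 hn
          exact ⟨c, d, ⟨fun _ => ⟨h1, h2⟩, fun h => absurd hk h⟩, h3⟩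
        · obtain ⟨h1, h2, h3⟩ := h.2 hk
          obtain ⟨c, d, h4, h5, h6, h7⟩ := h3.exists_extension h1 h2 hn
          exact ⟨c, d, ⟨fun h => absurd h hk, fun _ => ⟨h4, h5, h6⟩⟩, h7⟩)
    obtain ⟨e, ⟨c, hc⟩, he⟩ := hF.exists_index
    refine ⟨c, fun as has bs hbs hab => ⟨_, hc (as, bs), e (as, bs), rfl, _, he (as, bs), ?_⟩⟩
    obtain ⟨h1, h2, h3⟩ := hFspec (as, bs)
      ⟨fun h => ⟨has, h⟩, fun _ => ⟨has.1, hbs, hab⟩⟩ _ fun _ => rfl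
    refine ⟨h1, h2, fun hcl => isAutoOf_of_bijOnDom h1 fun cs hcs => ?_⟩
    obtain ⟨p, hp, hRp⟩ := h3 cs hcs
    exact ⟨p, hp, (hRp.1 ⟨has.1, hbs, hcl⟩).2⟩

end CFL
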